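/- Let p > 2 and q be such that 2/p + 2/q = 1. There exists a constant C > 0 such that for all φ ∈ L²(ℝ²): ‖I_x^{1/(2p)} I_y^{1/(2p)} U(t)φ‖_{L^p_t L^q_{x,y}} ≤ C ‖φ‖_{L²(ℝ²)}, where the norm is the L^p norm in time of the L^q(ℝ²) norm in space of the free solution. -/

import Mathlib

noncomputable section

open MeasureTheory Set
open scoped ENNReal NNReal

/-- Japanese bracket `⟨a⟩ = (1+a²)^{1/2}`. -/
def jb (a : ℝ) : ℝ := Real.sqrt (1 + a ^ 2)

/-- `⟨(ξ,η)⟩ = (1+ξ²+η²)^{1/2}`. -/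
def jb2 (ξ η : ℝ) : ℝ := Real.sqrt (1 + ξ ^ 2 + η ^ 2)

/-- Spatial Fourier transform on `ℝ²`. -/
def FT2 (f : ℝ × ℝ → ℂ) (p : ℝ × ℝ) : ℂ :=
  ∫ q : ℝ × ℝ, Complex.exp ((((-2) * Real.pi * (p.1 * q.1 + p.2 * q.2) : ℝ) : ℂ) * Complex.I) * f q

/-- Inverse spatial Fourier transform on `ℝ²`. -/
def IFT2 (f : ℝ × ℝ → ℂ) (p : ℝ × ℝ) : ℂ :=
  ∫ q : ℝ × ℝ, Complex.exp (((2 * Real.pi * (p.1 * q.1 + p.2 * q.2) : ℝ) : ℂ) * Complex.I) * f q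

/-- Space-time Fourier transform on `ℝ³`, variables `(t,x,y) ↦ (τ,ξ,η)`. -/
def FT3 (u : ℝ × ℝ × ℝ → ℂ) (p : ℝ × ℝ × ℝ) : ℂ :=
  ∫ q : ℝ × ℝ × ℝ, Complex.exp ((((-2) * Real.pi *
    (p.1 * q.1 + p.2.1 * q.2.1 + p.2.2 * q.2.2) : ℝ) : ℂ) * Complex.I) * u q

/-- Bourgain norm `‖u‖_{s,b}` with weight `⟨τ-ξ³-η³⟩^b⟨(ξ,η)⟩^s`
(symmetrized Zakharov-Kuznetsov equation). -/
def XN (s b : ℝ) (u : ℝ × ℝ × ℝ → ℂ) : ℝ≥0∞ :=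
  (∫⁻ p : ℝ × ℝ × ℝ,
    ENNReal.ofReal ((jb (p.1 - p.2.1 ^ 3 - p.2.2 ^ 3) ^ b * jb2 p.2.1 p.2.2 ^ s) ^ 2) *
      (‖FT3 u p‖₊ : ℝ≥0∞) ^ 2) ^ (1 / 2 : ℝ)

/-- `H^s(ℝ²)` norm. -/
def HN (s : ℝ) (φ : ℝ × ℝ → ℂ) : ℝ≥0∞ :=
  (∫⁻ q : ℝ × ℝ, ENNReal.ofReal ((jb2 q.1 q.2 ^ s) ^ 2) * (‖FT2 φ q‖₊ : ℝ≥0∞) ^ 2) ^ (1 / 2 : ℝ)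

/-- `L²(ℝ_t × ℝ²_{x,y})` norm. -/
def L2N (u : ℝ × ℝ × ℝ → ℂ) : ℝ≥0∞ :=
  (∫⁻ p : ℝ × ℝ × ℝ, (‖u p‖₊ : ℝ≥0∞) ^ 2) ^ (1 / 2 : ℝ)

/-- `L²(ℝ²)` norm. -/
def L2N2 (φ : ℝ × ℝ → ℂ) : ℝ≥0∞ :=
  (∫⁻ q : ℝ × ℝ, (‖φ q‖₊ : ℝ≥0∞) ^ 2) ^ (1 / 2 : ℝ)

/-- Mixed norm `L^p_t L^q_{x,y}`. -/
def LpLq (p q : ℝ) (u : ℝ × ℝ × ℝ → ℂ) : ℝ≥0∞ :=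
  (∫⁻ t : ℝ, (∫⁻ z : ℝ × ℝ, (‖u (t, z.1, z.2)‖₊ : ℝ≥0∞) ^ q) ^ (p / q)) ^ (1 / p)

/-- The unitary group `U(t) = e^{-t(∂_x³+∂_y³)}`, on the Fourier side
`(U(t)φ)^(ξ,η) = e^{it(ξ³+η³)} φ̂(ξ,η)`. -/
def Ugrp (t : ℝ) (φ : ℝ × ℝ → ℂ) : ℝ × ℝ → ℂ :=
  IFT2 fun q => Complex.exp (((t * (q.1 ^ 3 + q.2 ^ 3) : ℝ) : ℂ) * Complex.I) * FT2 φ q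

/-- Spatial Fourier multiplier operator (acting for each fixed time `t`). -/
def mult2 (m : ℝ × ℝ → ℂ) (u : ℝ × ℝ × ℝ → ℂ) : ℝ × ℝ × ℝ → ℂ :=
  fun p => IFT2 (fun q => m q * FT2 (fun z => u (p.1, z.1, z.2)) q) (p.2.1, p.2.2)

/-- Bilinear operator with symbol `a(ξ₁,ξ₂,η₁,η₂)`, acting for each fixed time `t` by
`(A(f,g))^(ξ,η) = ∫_{ξ=ξ₁+ξ₂, η=η₁+η₂} a f̂(ξ₁,η₁) ĝ(ξ₂,η₂) dξ₁ dη₁`. -/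
def bil (a : ℝ → ℝ → ℝ → ℝ → ℂ) (u v : ℝ × ℝ × ℝ → ℂ) : ℝ × ℝ × ℝ → ℂ :=
  fun p => IFT2 (fun ζ => ∫ w : ℝ × ℝ,
      a w.1 (ζ.1 - w.1) w.2 (ζ.2 - w.2) *
        FT2 (fun z => u (p.1, z.1, z.2)) w *
        FT2 (fun z => v (p.1, z.1, z.2)) (ζ.1 - w.1, ζ.2 - w.2)) (p.2.1, p.2.2)

/-- Symbol of the bilinear operator `I_x^{1/2} I_{x,-}^{1/2}`:
`|ξ₁+ξ₂|^{1/2}|ξ₁-ξ₂|^{1/2}`. -/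
def symIx : ℝ → ℝ → ℝ → ℝ → ℂ := fun ξ₁ ξ₂ _ _ =>
  ((|ξ₁ + ξ₂| ^ (1 / 2 : ℝ) * |ξ₁ - ξ₂| ^ (1 / 2 : ℝ) : ℝ) : ℂ)

/-- Symbol of the bilinear operator `I_y^{1/2} I_{y,-}^{1/2}`:
`|η₁+η₂|^{1/2}|η₁-η₂|^{1/2}`. -/
def symIy : ℝ → ℝ → ℝ → ℝ → ℂ := fun _ _ η₁ η₂ =>
  ((|η₁ + η₂| ^ (1 / 2 : ℝ) * |η₁ - η₂| ^ (1 / 2 : ℝ) : ℝ) : ℂ)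

/-- Sharp Fourier projection in the `y`-variable onto frequencies `η ∈ S`. -/
def PyS (S : Set ℝ) : (ℝ × ℝ × ℝ → ℂ) → ℝ × ℝ × ℝ → ℂ :=
  mult2 fun q => S.indicator (fun _ => (1 : ℂ)) q.2

/-- Dyadic projection `P_{y,k}` onto frequencies `|η| ≤ 2^k`. -/
def Pyk (k : ℤ) : (ℝ × ℝ × ℝ → ℂ) → ℝ × ℝ × ℝ → ℂ :=
  PyS {η : ℝ | |η| ≤ (2 : ℝ) ^ k}

/-- Bessel potential `J_y^s` in the `y`-variable, symbol `⟨η⟩^s`. -/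
def Jy (s : ℝ) : (ℝ × ℝ × ℝ → ℂ) → ℝ × ℝ × ℝ → ℂ :=
  mult2 fun q => ((jb q.2 ^ s : ℝ) : ℂ)

/-- Bessel potential `J_x^s` in the `x`-variable, symbol `⟨ξ⟩^s`. -/
def Jx (s : ℝ) : (ℝ × ℝ × ℝ → ℂ) → ℝ × ℝ × ℝ → ℂ :=
  mult2 fun q => ((jb q.1 ^ s : ℝ) : ℂ)

/-- The operator `∂_x + ∂_y`, with spatial Fourier symbol `i(ξ+η)`. -/
def DxDy : (ℝ × ℝ × ℝ → ℂ) → ℝ × ℝ × ℝ → ℂ :=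
  mult2 fun q => Complex.I * ((q.1 + q.2 : ℝ) : ℂ)

/-- A fixed smooth, even cut-off `ψ ∈ C₀^∞(-2,2)`, `0 ≤ ψ ≤ 1`, `ψ = 1` on `[-1,1]`. -/
def IsCutoff (ψ : ℝ → ℝ) : Prop :=
  ContDiff ℝ (⊤ : ℕ∞) ψ ∧ HasCompactSupport ψ ∧ tsupport ψ ⊆ Set.Ioo (-2) 2 ∧
    (∀ t, ψ (-t) = ψ t) ∧ (∀ t, ψ t ∈ Set.Icc (0 : ℝ) 1) ∧ (∀ t, |t| ≤ 1 → ψ t = 1)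



lemma lintegral_abs_eq (f : ℝ → ℝ≥0∞) :
    ∫⁻ x : ℝ, f |x| = 2 * ∫⁻ x in Ioi (0:ℝ), f x := by
  have h1 : ∫⁻ x : ℝ, f |x| = (∫⁻ x in Ioi (0:ℝ), f |x|) + ∫⁻ x in (Ioi (0:ℝ))ᶜ, f |x| :=
    (lintegral_add_compl _ measurableSet_Ioi).symm
  have h2 : ∫⁻ x in Ioi (0:ℝ), f |x| = ∫⁻ x in Ioi (0:ℝ), f x := by
    refine setLIntegral_congr_fun measurableSet_Ioi (fun x hx => ?_)
    simp only [abs_of_pos (show (0:ℝ) < x from hx)]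
  have h3 : ∫⁻ x in (Ioi (0:ℝ))ᶜ, f |x| = ∫⁻ x in Ioi (0:ℝ), f x := by
    rw [compl_Ioi, setLIntegral_congr (Iio_ae_eq_Iic (μ := volume) (a := (0:ℝ))).symm]
    rw [← lintegral_indicator measurableSet_Iio, ← lintegral_indicator measurableSet_Ioi,
      ← lintegral_neg_eq_self]
    refine lintegral_congr (fun x => ?_)
    by_cases hx : 0 < x
    · simp [indicator, hx, abs_of_pos hx]
    · simp [indicator, hx]
  rw [h1, h2, h3, two_mul]

lemma lint_near (l r : ℝ) (hl1 : l < 1) (hr : 0 < r) :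
    ∫⁻ s : ℝ, (if |s| < r then ENNReal.ofReal (|s| ^ (-l)) else 0)
      = 2 * ENNReal.ofReal (r ^ (1 - l) / (1 - l)) := by
  have hm : Measurable (fun s : ℝ => if s < r then ENNReal.ofReal (s ^ (-l)) else 0) := by
    refine Measurable.ite measurableSet_Iio ?_ measurable_const
    fun_prop
  rw [lintegral_abs_eq (fun s => if s < r then ENNReal.ofReal (s ^ (-l)) else 0)]
  congr 1
  have : ∫⁻ x in Ioi (0:ℝ), (if x < r then ENNReal.ofReal (x ^ (-l)) else 0)
      = ∫⁻ x in Ioc (0:ℝ) r, ENNReal.ofReal (x ^ (-l)) := by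
    rw [← setLIntegral_congr (Ioo_ae_eq_Ioc (μ := volume) (a := (0:ℝ)) (b := r)),
      ← lintegral_indicator measurableSet_Ioo, ← lintegral_indicator measurableSet_Ioi]
    refine lintegral_congr (fun x => ?_)
    by_cases hx : 0 < x <;> by_cases hx2 : x < r <;> simp [indicator, hx, hx2]
  rw [this, ← ofReal_integral_eq_lintegral_ofReal]
  · rw [← intervalIntegral.integral_of_le hr.le, integral_rpow (Or.inl (by linarith))]
    rw [Real.zero_rpow (by linarith)]
    congr 1
    rw [sub_zero]; ring_nf
  · have := (intervalIntegral.intervalIntegrable_rpow' (a := 0) (b := r) (r := -l) (by linarith))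
    exact (intervalIntegrable_iff_integrableOn_Ioc_of_le hr.le).1 this
  · refine (ae_restrict_iff' measurableSet_Ioc).2 (Filter.Eventually.of_forall fun x hx => ?_)
    exact Real.rpow_nonneg hx.1.le _

lemma lint_far (r : ℝ) (hr : 0 < r) :
    ∫⁻ s : ℝ, (if |s| < r then 0 else ENNReal.ofReal (|s| ^ (-2:ℝ)))
      = 2 * ENNReal.ofReal (r⁻¹) := by
  have hm : Measurable (fun s : ℝ => if s < r then 0 else ENNReal.ofReal (s ^ (-2:ℝ))) := by
    refine Measurable.ite measurableSet_Iio measurable_const ?_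
    fun_prop
  rw [lintegral_abs_eq (fun s => if s < r then 0 else ENNReal.ofReal (s ^ (-2:ℝ)))]
  congr 1
  have : ∫⁻ x in Ioi (0:ℝ), (if x < r then 0 else ENNReal.ofReal (x ^ (-2:ℝ)))
      = ∫⁻ x in Ioi r, ENNReal.ofReal (x ^ (-2:ℝ)) := by
    rw [setLIntegral_congr (Ioi_ae_eq_Ici (μ := volume) (a := r)),
      ← lintegral_indicator measurableSet_Ici, ← lintegral_indicator measurableSet_Ioi]
    refine lintegral_congr (fun x => ?_)
    by_cases hx2 : x < r
    · by_cases hx : 0 < x <;> simp [indicator, hx, hx2]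
    · have hx : 0 < x := by linarith
      simp [indicator, hx, hx2, not_lt.1 hx2]
  rw [this, ← ofReal_integral_eq_lintegral_ofReal]
  · rw [integral_Ioi_rpow_of_lt (by norm_num) hr]
    congr 1
    norm_num
    rw [Real.rpow_neg_one]
  · exact integrableOn_Ioi_rpow_of_lt (by norm_num) hr
  · refine (ae_restrict_iff' measurableSet_Ioi).2 (Filter.Eventually.of_forall fun x hx => ?_)
    exact Real.rpow_nonneg (hr.le.trans (le_of_lt hx)) _


lemma hls_point (p P : ℝ) (hp : 2 < p) (hP : P = p / (p - 1)) (a : ℝ → ℝ) (ham : Measurable a)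
    (A : ℝ) (hA : 0 < A)
    (hAe : (∫⁻ s, ENNReal.ofReal (a s) ^ P) ^ (1 / P) = ENNReal.ofReal A) (t x : ℝ) (hx : 0 < x) :
    ∫⁻ s, (if a s ≤ x then ENNReal.ofReal (|t - s| ^ (-(2 / p))) * ENNReal.ofReal (a s) else 0)
      ≤ ENNReal.ofReal ((2 / (1 - 2 / p) + 2) * (x ^ (P - 1) * A ^ (2 - P))) := by
  have hp0 : 0 < p := by linarith
  have hp1 : 0 < p - 1 := by linarith
  have hl1 : 2 / p < 1 := by rw [div_lt_one hp0]; exact hp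
  have hP1 : P - 1 = 1 / (p - 1) := by rw [hP]; field_simp; ring
  have hconj : P.HolderConjugate p := by
    rw [Real.holderConjugate_iff]
    constructor
    · have : 0 < P - 1 := by rw [hP1]; positivity
      linarith
    · rw [hP]; field_simp; ring
  set r := (A / x) ^ P with hr
  have hr0 : 0 < r := Real.rpow_pos_of_pos (div_pos hA hx) _
  have e1 : x * r ^ (1 - 2 / p) = x ^ (P - 1) * A ^ (2 - P) := by
    have : P * (1 - 2 / p) = 2 - P := by rw [hP]; field_simp; ring
    rw [hr, ← Real.rpow_mul (div_pos hA hx).le, this, Real.div_rpow hA.le hx.le]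
    have h2 : x ^ (P - 1) * x ^ (2 - P) = x := by
      rw [← Real.rpow_add hx]; ring_nf; exact Real.rpow_one x
    have h3 : 0 < x ^ (2 - P) := Real.rpow_pos_of_pos hx _
    field_simp
    rw [mul_comm, h2]
  have e2 : (r⁻¹) ^ (1 / p) * A = x ^ (P - 1) * A ^ (2 - P) := by
    have h4 : P * (1 / p) = P - 1 := by rw [hP]; field_simp; ring
    rw [hr, Real.inv_rpow hr0.le, ← Real.rpow_mul (div_pos hA hx).le, h4,
      Real.div_rpow hA.le hx.le]
    have h2 : A ^ (2 - P) * A ^ (P - 1) = A := by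
      rw [← Real.rpow_add hA]; ring_nf; exact Real.rpow_one A
    have h3 : 0 < A ^ (P - 1) := Real.rpow_pos_of_pos hA _
    rw [inv_div]
    field_simp
    rw [mul_comm, h2]
  have near : ∫⁻ s, (if |t - s| < r then ENNReal.ofReal (|t - s| ^ (-(2 / p))) else 0)
      * ENNReal.ofReal x ≤ ENNReal.ofReal (2 / (1 - 2 / p) * (x ^ (P - 1) * A ^ (2 - P))) := by
    have hmm : Measurable (fun s : ℝ => if |s| < r then ENNReal.ofReal (|s| ^ (-(2 / p))) else 0) :=
      Measurable.ite (measurableSet_lt (by fun_prop) measurable_const) (by fun_prop)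
        measurable_const
    rw [lintegral_mul_const _ (Measurable.ite (measurableSet_lt (by fun_prop) measurable_const)
        (by fun_prop) measurable_const),
      lintegral_sub_left_eq_self (fun s : ℝ =>
      if |s| < r then ENNReal.ofReal (|s| ^ (-(2 / p))) else 0) t, lint_near _ _ hl1 hr0]
    rw [← e1, show (2:ℝ≥0∞) = ENNReal.ofReal 2 by simp, ← ENNReal.ofReal_mul (by norm_num),
      ← ENNReal.ofReal_mul (by have := Real.rpow_nonneg hr0.le (1 - 2/p); have : 0 < 1 - 2/p := by linarith
                               positivity)]
    apply ENNReal.ofReal_le_ofReal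
    apply le_of_eq
    ring
  have far : ∫⁻ s, ENNReal.ofReal (a s) *
      (if |t - s| < r then 0 else ENNReal.ofReal (|t - s| ^ (-(2 / p))))
       ≤ ENNReal.ofReal (2 * (x ^ (P - 1) * A ^ (2 - P))) := by
    have hmm : Measurable (fun s : ℝ => if |s| < r then 0 else ENNReal.ofReal (|s| ^ (-(2 / p)))) :=
      Measurable.ite (measurableSet_lt (by fun_prop) measurable_const) 
        measurable_const (by fun_prop)
    have H := ENNReal.lintegral_mul_le_Lp_mul_Lq volume hconj (f := fun s => ENNReal.ofReal (a s))
      (g := fun s => (if |t - s| < r then 0 else ENNReal.ofReal (|t - s| ^ (-(2 / p)))))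
      (by fun_prop) (hmm.comp (measurable_const.sub measurable_id)).aemeasurable
    refine H.trans ?_
    rw [hAe]
    have h5 : ∫⁻ s, (if |t - s| < r then 0 else ENNReal.ofReal (|t - s| ^ (-(2 / p)))) ^ p
        = 2 * ENNReal.ofReal (r⁻¹) := by
      rw [← lint_far r hr0, ← lintegral_sub_left_eq_self (fun s : ℝ =>
        if |s| < r then 0 else ENNReal.ofReal (|s| ^ (-2:ℝ))) t]
      refine lintegral_congr fun s => ?_
      split_ifs with h
      · exact ENNReal.zero_rpow_of_pos hp0
      · rw [ENNReal.ofReal_rpow_of_nonneg (by positivity) hp0.le, ← Real.rpow_mul (abs_nonneg _)]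
        congr 2; field_simp
    rw [h5, ENNReal.mul_rpow_of_nonneg _ _ (by positivity),
      ENNReal.ofReal_rpow_of_pos (by positivity), ← e2]
    have h6 : (2:ℝ≥0∞) ^ (1 / p) ≤ 2 := by
      conv_rhs => rw [← ENNReal.rpow_one 2]
      apply ENNReal.rpow_le_rpow_of_exponent_le (by norm_num)
      rw [div_le_one hp0]; linarith
    calc _ ≤ ENNReal.ofReal A * (2 * ENNReal.ofReal (r⁻¹ ^ (1 / p))) := by gcongr
      _ = ENNReal.ofReal (2 * (r⁻¹ ^ (1 / p) * A)) := by
        rw [ENNReal.ofReal_mul (by norm_num), ENNReal.ofReal_mul (by positivity)]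
        simp; ring
  calc _ ≤ ∫⁻ s, ((if |t - s| < r then ENNReal.ofReal (|t - s| ^ (-(2 / p))) else 0)
      * ENNReal.ofReal x + ENNReal.ofReal (a s) *
      (if |t - s| < r then 0 else ENNReal.ofReal (|t - s| ^ (-(2 / p))))) := by
        refine lintegral_mono fun s => ?_
        by_cases h1 : a s ≤ x <;> by_cases h2 : |t - s| < r <;> simp only [h1, h2, if_true, if_false]
        · simp; gcongr
        · simp [mul_comm]
        · simp
        · simp
    _ = _ + _ := lintegral_add_right _ (by
        refine Measurable.mul (by fun_prop) ?_
        exact Measurable.ite (measurableSet_lt (by fun_prop) measurable_const) 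
          measurable_const (by fun_prop))
    _ ≤ _ := add_le_add near far
    _ = _ := by
      rw [← ENNReal.ofReal_add, add_mul]
      · have : 0 < 1 - 2/p := by linarith
        positivity
      · positivity

lemma hls (p P : ℝ) (hp : 2 < p) (hP : P = p / (p - 1)) : ∃ C : ℝ≥0, 0 < C ∧
    ∀ a : ℝ → ℝ, Measurable a → (∀ t, 0 ≤ a t) →
    ∫⁻ t, ∫⁻ s, ENNReal.ofReal (|t - s| ^ (-(2 / p))) * ENNReal.ofReal (a s) * ENNReal.ofReal (a t)
      ≤ C * (∫⁻ s, ENNReal.ofReal (a s) ^ P) ^ (2 / P) := by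
  have hp0 : 0 < p := by linarith
  have hp1 : 0 < p - 1 := by linarith
  have hP0 : 0 < P := by rw [hP]; positivity
  have hP1 : P - 1 = 1 / (p - 1) := by rw [hP]; field_simp; ring
  have hl1 : 2 / p < 1 := by rw [div_lt_one hp0]; exact hp
  have hc0 : (0:ℝ) < 2 * (2 / (1 - 2 / p) + 2) := by
    have : 0 < 1 - 2/p := by linarith
    positivity
  refine ⟨Real.toNNReal (2 * (2 / (1 - 2 / p) + 2)), by simpa using hc0, fun a ham ha0 => ?_⟩
  set I := ∫⁻ s, ENNReal.ofReal (a s) ^ P with hI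
  by_cases hIt : I = ⊤
  · rw [hIt, ENNReal.top_rpow_of_pos (by positivity), ENNReal.mul_top]
    · exact le_top
    · simpa using hc0
  by_cases hI0 : I = 0
  · have h1 : ∀ᵐ s, ENNReal.ofReal (a s) = 0 := by
      have := (lintegral_eq_zero_iff (by fun_prop)).1 hI0
      filter_upwards [this] with s hs
      simpa [hP0, hP0.not_gt] using hs
    have : ∀ t, ∫⁻ s, ENNReal.ofReal (|t - s| ^ (-(2 / p))) * ENNReal.ofReal (a s)
        * ENNReal.ofReal (a t) = 0 := by
      intro t
      rw [lintegral_eq_zero_iff (by fun_prop)]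
      filter_upwards [h1] with s hs
      simp [hs]
    simp [this]
  set A := (I ^ (1 / P)).toReal with hA
  have hIP : I ^ (1 / P) ≠ ⊤ := ENNReal.rpow_ne_top_of_nonneg (by positivity) hIt
  have hAe : I ^ (1 / P) = ENNReal.ofReal A := (ENNReal.ofReal_toReal hIP).symm
  have hIP0 : I ^ (1 / P) ≠ 0 := by
    simp [hI0, hP0, hP0.not_gt]
  have hA0 : 0 < A := ENNReal.toReal_pos hIP0 hIP
  set k : ℝ → ℝ → ℝ≥0∞ := fun t s => ENNReal.ofReal (|t - s| ^ (-(2 / p))) * ENNReal.ofReal (a s)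
    * ENNReal.ofReal (a t) with hk
  have hkm : Measurable (fun z : ℝ × ℝ => if a z.2 ≤ a z.1 then k z.1 z.2 else 0) := by
    refine Measurable.ite (measurableSet_le (by fun_prop) (by fun_prop)) ?_ measurable_const
    simp only [hk]; fun_prop
  have hkm' : Measurable (fun z : ℝ × ℝ => if a z.1 ≤ a z.2 then k z.1 z.2 else 0) := by
    refine Measurable.ite (measurableSet_le (by fun_prop) (by fun_prop)) ?_ measurable_const
    simp only [hk]; fun_prop
  have hks : ∀ t s, k t s = k s t := by
    intro t s; simp only [hk]; rw [abs_sub_comm]; ring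
  have main : ∫⁻ t, ∫⁻ s, (if a s ≤ a t then k t s else 0) ≤
      ENNReal.ofReal (2 / (1 - 2 / p) + 2) * I ^ (2 / P) := by
    have pt : ∀ t, ∫⁻ s, (if a s ≤ a t then k t s else 0) ≤
        ENNReal.ofReal ((2 / (1 - 2 / p) + 2) * A ^ (2 - P)) * ENNReal.ofReal (a t) ^ P := by
      intro t
      rcases (ha0 t).eq_or_lt with h0 | h0
      · simp [hk, ← h0]
      have := hls_point p P hp hP a ham A hA0 hAe t (a t) h0
      calc _ = ∫⁻ s, (if a s ≤ a t then ENNReal.ofReal (|t - s| ^ (-(2 / p))) * ENNReal.ofReal (a s)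
          else 0) * ENNReal.ofReal (a t) := by
            refine lintegral_congr fun s => ?_
            split_ifs <;> simp [hk]
        _ = _ * _ := lintegral_mul_const _ (by
              exact Measurable.ite (measurableSet_le (by fun_prop) (by fun_prop)) (by fun_prop)
                measurable_const)
        _ ≤ _ := mul_le_mul_left this _
        _ = _ := by
          rw [ENNReal.ofReal_rpow_of_pos h0, ← ENNReal.ofReal_mul, ← ENNReal.ofReal_mul]
          · congr 1
            have : a t ^ P = a t ^ (P - 1) * a t := by
              rw [← Real.rpow_add_one h0.ne']; ring_nf
            rw [this]; ring
          · have : 0 < 1 - 2/p := by linarith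
            positivity
          · have : 0 < 1 - 2/p := by linarith
            positivity
    refine (lintegral_mono pt).trans ?_
    rw [lintegral_const_mul _ (by fun_prop), ← hI, ENNReal.ofReal_mul (by
      have : 0 < 1 - 2/p := by linarith
      positivity), mul_assoc]
    gcongr
    have hIA : I = ENNReal.ofReal A ^ P := by
      rw [← hAe, ← ENNReal.rpow_mul]; field_simp; simp
    rw [hIA, ← ENNReal.rpow_mul, ENNReal.ofReal_rpow_of_pos hA0, ENNReal.ofReal_rpow_of_pos hA0,
      ← ENNReal.ofReal_mul (by positivity), ← Real.rpow_add hA0]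
    apply le_of_eq
    congr 2; field_simp; ring
  calc _ ≤ ∫⁻ t, ∫⁻ s, ((if a s ≤ a t then k t s else 0) + (if a t ≤ a s then k t s else 0)) := by
        refine lintegral_mono fun t => lintegral_mono fun s => ?_
        change k t s ≤ _
        rcases le_total (a s) (a t) with h | h <;> simp [h]
    _ = (∫⁻ t, ∫⁻ s, (if a s ≤ a t then k t s else 0)) +
        ∫⁻ t, ∫⁻ s, (if a t ≤ a s then k t s else 0) := by
        rw [← lintegral_add_left hkm.lintegral_prod_right']
        refine lintegral_congr fun t => ?_
        rw [← lintegral_add_left]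
        exact hkm.comp (measurable_const.prodMk measurable_id)
    _ = (∫⁻ t, ∫⁻ s, (if a s ≤ a t then k t s else 0)) +
        ∫⁻ t, ∫⁻ s, (if a s ≤ a t then k t s else 0) := by
        congr 1
        rw [lintegral_lintegral_swap hkm'.aemeasurable]
        simp only [hks]
    _ ≤ _ := by
        refine (add_le_add main main).trans (le_of_eq ?_)
        rw [← ENNReal.ofReal, ENNReal.ofReal_mul (by norm_num)]
        simp; ring


/-- One-dimensional oscillatory integrand. -/
def oscE (w : ℂ) (τ y ξ : ℝ) : ℂ :=
  Complex.exp (w * (Real.log ξ : ℂ) + ((τ * ξ ^ 3 + y * ξ : ℝ) : ℂ) * Complex.I)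

lemma oscE_norm_exp (w : ℂ) (hw : w.re = 1 / 2) (τ y ξ : ℝ) :
    ‖oscE w τ y ξ‖ = Real.exp (Real.log ξ / 2) := by
  rw [oscE, Complex.norm_exp]
  congr 1
  rw [Complex.add_re, Complex.re_mul_ofReal, Complex.re_ofReal_mul, hw, Complex.I_re]
  ring

lemma oscE_norm (w : ℂ) (hw : w.re = 1 / 2) (τ y ξ : ℝ) (hξ : 0 < ξ) :
    ‖oscE w τ y ξ‖ = √ξ := by
  rw [oscE_norm_exp w hw]
  rw [Real.sqrt_eq_rpow, Real.rpow_def_of_pos hξ]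
  congr 1; ring

lemma oscE_norm_le (w : ℂ) (hw : w.re = 1 / 2) (τ y ξ : ℝ) :
    ‖oscE w τ y ξ‖ ≤ 1 + √|ξ| := by
  rcases lt_trichotomy ξ 0 with h | h | h
  · rw [oscE_norm_exp w hw]
    rw [← Real.log_abs, Real.sqrt_eq_rpow, Real.rpow_def_of_pos (abs_pos.2 h.ne)]
    rw [show Real.log |ξ| / 2 = Real.log |ξ| * (1 / 2) by ring]
    linarith
  · subst h
    simp [oscE]
  · rw [oscE_norm w hw _ _ _ h, abs_of_pos h]; linarith

lemma oscE_measurable (w : ℂ) (τ y : ℝ) : Measurable (oscE w τ y) := by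
  unfold oscE
  fun_prop

lemma oscE_intervalIntegrable (w : ℂ) (hw : w.re = 1 / 2) (τ y a b : ℝ) :
    IntervalIntegrable (oscE w τ y) volume a b := by
  have : IntervalIntegrable (fun ξ : ℝ => 1 + √|ξ|) volume a b :=
    (by fun_prop : Continuous (fun ξ : ℝ => 1 + √|ξ|)).intervalIntegrable _ _
  refine this.mono_fun (oscE_measurable w τ y).aestronglyMeasurable ?_
  refine Filter.Eventually.of_forall fun ξ => ?_
  refine (oscE_norm_le w hw τ y ξ).trans ?_
  exact le_abs_self _

lemma oscE_triv (w : ℂ) (hw : w.re = 1 / 2) (τ y a b : ℝ) (ha : 0 ≤ a) (hab : a ≤ b) :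
    ‖∫ ξ in a..b, oscE w τ y ξ‖ ≤ √b * (b - a) := by
  have := intervalIntegral.norm_integral_le_of_norm_le_const (a := a) (b := b)
    (f := oscE w τ y) (C := √b) ?_
  · rwa [abs_of_nonneg (by linarith)] at this
  · intro x hx
    rw [uIoc_of_le hab] at hx
    rw [oscE_norm w hw _ _ _ (ha.trans_lt hx.1)]
    exact Real.sqrt_le_sqrt hx.2

lemma oscE_ibp (w : ℂ) (hw : w.re = 1 / 2) (c a b e M L : ℝ) (ha : 0 < a) (hab : a ≤ b)
    (he : ∀ ξ ∈ Icc a b, ξ - e ≠ 0) (hD : ∀ ξ ∈ Icc a b, 3 * ξ ^ 2 + c ≠ 0)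
    (hB : ∀ ξ ∈ Icc a b, √ξ * (‖w‖ / (ξ * |3 * ξ ^ 2 + c|) + 6 * ξ / (3 * ξ ^ 2 + c) ^ 2)
      ≤ M / (ξ - e) ^ 2 + L) :
    ‖∫ ξ in a..b, oscE w 1 c ξ‖ ≤ √a / |3 * a ^ 2 + c| + √b / |3 * b ^ 2 + c|
      + (M * (1 / (a - e) - 1 / (b - e)) + L * (b - a)) := by
  set D : ℝ → ℝ := fun ξ => 3 * ξ ^ 2 + c with hDdef
  set R : ℝ → ℂ := fun ξ => oscE w 1 c ξ *
    (w / (ξ * (Complex.I * D ξ)) - 6 * ξ / (Complex.I * D ξ ^ 2)) with hR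
  have hpos : ∀ ξ ∈ Icc a b, 0 < ξ := fun ξ h => ha.trans_le h.1
  have hder : ∀ ξ ∈ uIcc a b, HasDerivAt (fun ξ : ℝ => oscE w 1 c ξ / (Complex.I * D ξ))
      (oscE w 1 c ξ + R ξ) ξ := by
    intro ξ hξ
    rw [uIcc_of_le hab] at hξ
    have hx := hpos ξ hξ
    have hd := hD ξ hξ
    have h1 : HasDerivAt (fun ξ : ℝ => ((Real.log ξ : ℝ) : ℂ)) ((ξ⁻¹ : ℝ) : ℂ) ξ :=
      (Real.hasDerivAt_log hx.ne').ofReal_comp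
    have h2 : HasDerivAt (fun ξ : ℝ => ((1 * ξ ^ 3 + c * ξ : ℝ) : ℂ)) ((D ξ : ℝ) : ℂ) ξ := by
      refine HasDerivAt.ofReal_comp ?_
      have := ((hasDerivAt_id ξ).pow 3).const_mul 1 |>.add ((hasDerivAt_id ξ).const_mul c)
      refine this.congr_deriv ?_
      simp [hDdef]
    have h3 : HasDerivAt (fun ξ : ℝ => ((D ξ : ℝ) : ℂ)) ((6 * ξ : ℝ) : ℂ) ξ := by
      refine HasDerivAt.ofReal_comp ?_
      have := (((hasDerivAt_id ξ).pow 2).const_mul 3).add_const c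
      refine this.congr_deriv ?_
      simp; ring
    have h4 := ((h1.const_mul w).add (h2.mul_const Complex.I)).cexp
    have h5 := h4.div (h3.const_mul Complex.I) (by
      have : (D ξ : ℂ) ≠ 0 := by exact_mod_cast hd
      simp [this])
    refine h5.congr_deriv ?_
    have hxc : (ξ : ℂ) ≠ 0 := by exact_mod_cast hx.ne'
    have hdc : (D ξ : ℂ) ≠ 0 := by exact_mod_cast hd
    simp only [hR, oscE, Pi.add_apply]
    push_cast
    field_simp
    ring
  have hcE : ContinuousOn (oscE w 1 c) (uIcc a b) := by
    rw [uIcc_of_le hab]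
    unfold oscE
    refine ContinuousOn.cexp (ContinuousOn.add (ContinuousOn.mul continuousOn_const ?_) (by fun_prop))
    refine Complex.continuous_ofReal.comp_continuousOn (Real.continuousOn_log.mono ?_)
    intro x hx; exact (hpos x hx).ne'
  have hcR : ContinuousOn R (uIcc a b) := by
    refine hcE.mul ?_
    rw [uIcc_of_le hab]
    refine ContinuousOn.sub (ContinuousOn.div continuousOn_const (by fun_prop) ?_)
      (ContinuousOn.div (by fun_prop) (by fun_prop) ?_)
    · intro ξ hξ
      have := hpos ξ hξ; have := hD ξ hξ
      have hxc : (ξ : ℂ) ≠ 0 := by exact_mod_cast (hpos ξ hξ).ne'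
      have hdc : (D ξ : ℂ) ≠ 0 := by exact_mod_cast hD ξ hξ
      simp [hxc, hdc]
    · intro ξ hξ
      have hdc : (D ξ : ℂ) ≠ 0 := by exact_mod_cast hD ξ hξ
      simp [hdc]
  have hint := intervalIntegral.integral_eq_sub_of_hasDerivAt hder
    (hcE.add hcR).intervalIntegrable
  rw [intervalIntegral.integral_add hcE.intervalIntegrable hcR.intervalIntegrable] at hint
  have hRn : ∀ ξ ∈ Icc a b, ‖R ξ‖ ≤ M / (ξ - e) ^ 2 + L := by
    intro ξ hξ
    refine le_trans ?_ (hB ξ hξ)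
    have hx := hpos ξ hξ
    simp only [hR]
    rw [norm_mul, oscE_norm w hw _ _ _ hx]
    gcongr
    refine (norm_sub_le _ _).trans (le_of_eq ?_)
    simp [abs_of_pos hx]
    rfl
  have hRi : ‖∫ ξ in a..b, R ξ‖ ≤ M * (1 / (a - e) - 1 / (b - e)) + L * (b - a) := by
    have hcB : ContinuousOn (fun ξ : ℝ => M / (ξ - e) ^ 2 + L) (uIcc a b) := by
      rw [uIcc_of_le hab]
      refine ContinuousOn.add (ContinuousOn.div continuousOn_const (by fun_prop) ?_) continuousOn_const
      intro ξ hξ; exact pow_ne_zero _ (he ξ hξ)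
    have h1 := intervalIntegral.norm_integral_le_of_norm_le hab (f := R)
      (g := fun ξ : ℝ => M / (ξ - e) ^ 2 + L)
      (μ := volume) (Filter.Eventually.of_forall fun ξ hξ => hRn ξ (Ioc_subset_Icc_self hξ))
      hcB.intervalIntegrable
    refine h1.trans (le_of_eq ?_)
    have h2 : ∀ ξ ∈ uIcc a b, HasDerivAt (fun ξ : ℝ => -(M * (ξ - e)⁻¹) + L * ξ)
        (M / (ξ - e) ^ 2 + L) ξ := by
      intro ξ hξ
      rw [uIcc_of_le hab] at hξ
      have h3 := (((((hasDerivAt_id ξ).sub_const e).inv (he ξ hξ)).const_mul M).neg).add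
        ((hasDerivAt_id ξ).const_mul L)
      refine h3.congr_deriv ?_
      simp; ring
    rw [intervalIntegral.integral_eq_sub_of_hasDerivAt h2 hcB.intervalIntegrable]
    ring
  have hG : ∀ ξ ∈ Icc a b, ‖oscE w 1 c ξ / (Complex.I * D ξ)‖ = √ξ / |3 * ξ ^ 2 + c| := by
    intro ξ hξ
    rw [norm_div, oscE_norm w hw _ _ _ (hpos ξ hξ)]
    simp; rfl
  have hfin : ∫ ξ in a..b, oscE w 1 c ξ = oscE w 1 c b / (Complex.I * D b)
      - oscE w 1 c a / (Complex.I * D a) - ∫ ξ in a..b, R ξ := by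
    rw [← hint]; ring
  rw [hfin]
  refine (norm_sub_le _ _).trans (add_le_add ((norm_sub_le _ _).trans ?_) hRi)
  rw [hG a ⟨le_rfl, hab⟩, hG b ⟨hab, le_rfl⟩, add_comm]


lemma osc_caseA (w : ℂ) (hw : w.re = 1 / 2) (c a b : ℝ) (hc : -3 ≤ c) (ha : 2 ≤ a) (hab : a ≤ b) :
    ‖∫ ξ in a..b, oscE w 1 c ξ‖ ≤ 4 + ‖w‖ := by
  have hW : 0 ≤ ‖w‖ := norm_nonneg w
  have hDl : ∀ ξ : ℝ, 2 ≤ ξ → 9 / 4 * ξ ^ 2 ≤ 3 * ξ ^ 2 + c := fun ξ h => by nlinarith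
  have hbd : ∀ ξ : ℝ, 2 ≤ ξ → √ξ / |3 * ξ ^ 2 + c| ≤ 1 := by
    intro ξ h
    have h1 := hDl ξ h
    have h2 : √ξ ≤ ξ := by
      rw [Real.sqrt_le_left (by linarith)]; nlinarith
    rw [abs_of_nonneg (by nlinarith), div_le_one (by nlinarith)]
    nlinarith
  have H := oscE_ibp w hw c a b 0 (‖w‖ + 2) 0 (by linarith) hab
    (fun ξ h => by have := h.1; simp; linarith)
    (fun ξ h => by have h1 := h.1; have := hDl ξ (by linarith); nlinarith) ?_
  · refine H.trans ?_
    have h1 := hbd a ha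
    have h2 := hbd b (ha.trans hab)
    have h3 : 1 / (a - 0) - 1 / (b - 0) ≤ 1 := by
      have : 0 ≤ 1 / (b - 0) := by rw [sub_zero]; have : 0 < b := by linarith
                                   positivity
      have : 1 / (a - 0) ≤ 1 := by rw [sub_zero, div_le_one (by linarith)]; linarith
      linarith
    nlinarith
  · intro ξ h
    have hξ : 2 ≤ ξ := ha.trans h.1
    have h1 := hDl ξ hξ
    set D := 3 * ξ ^ 2 + c
    set y := √ξ with hy
    have hyy : ξ = y ^ 2 := (Real.sq_sqrt (by linarith)).symm
    have hy1 : 1 ≤ y := by rw [hy]; exact Real.one_le_sqrt.2 (by linarith)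
    rw [hyy] at h1
    have hy0 : 0 < y := by linarith
    have hD0 : 0 < D := by nlinarith [pow_pos hy0 4]
    rw [abs_of_pos hD0, hyy, sub_zero, add_zero, mul_add]
    have e1 : y * (‖w‖ / (y ^ 2 * D)) ≤ ‖w‖ / (y ^ 2) ^ 2 := by
      rw [mul_div_assoc', div_le_div_iff₀ (by positivity) (by positivity)]
      have : y * (y ^ 2) ^ 2 ≤ y ^ 2 * D := by nlinarith [pow_pos hy0 4, pow_pos hy0 5]
      nlinarith
    have e2 : y * (6 * y ^ 2 / D ^ 2) ≤ 2 / (y ^ 2) ^ 2 := by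
      rw [mul_div_assoc', div_le_div_iff₀ (by positivity) (by positivity)]
      have : (9 / 4 * (y ^ 2) ^ 2) ^ 2 ≤ D ^ 2 := by gcongr
      have : y ^ 7 ≤ y ^ 8 := by gcongr <;> linarith
      nlinarith
    calc _ ≤ ‖w‖ / (y ^ 2) ^ 2 + 2 / (y ^ 2) ^ 2 := add_le_add e1 e2
      _ = _ := by ring

lemma osc_caseB_right (w : ℂ) (hw : w.re = 1 / 2) (r a b : ℝ) (hr : 1 ≤ r) (ha : r ^ 2 + 1 / r ≤ a)
    (hab : a ≤ b) :
    ‖∫ ξ in a..b, oscE w 1 (-3 * r ^ 4) ξ‖ ≤ 2 + ‖w‖ := by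
  have hW : 0 ≤ ‖w‖ := norm_nonneg w
  have hr0 : 0 < r := by linarith
  have hr1 : 0 < 1 / r := by positivity
  have hDe : ∀ ξ : ℝ, 3 * ξ ^ 2 + (-3 * r ^ 4) = 3 * (ξ - r ^ 2) * (ξ + r ^ 2) := fun ξ => by ring
  have hDl : ∀ ξ : ℝ, r ^ 2 + 1 / r ≤ ξ → 3 * (ξ - r ^ 2) * ξ ≤ 3 * ξ ^ 2 + (-3 * r ^ 4) := fun ξ h => by
    rw [hDe]
    have : 0 < ξ - r ^ 2 := by linarith
    have : 0 < r ^ 2 := by positivity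
    gcongr; linarith
  have hDp : ∀ ξ : ℝ, r ^ 2 + 1 / r ≤ ξ → 0 < 3 * ξ ^ 2 + (-3 * r ^ 4) := fun ξ h => by
    have h0 : 0 < ξ - r ^ 2 := by linarith
    have h1 : 0 < r ^ 2 := by positivity
    have : 0 < 3 * (ξ - r ^ 2) * ξ := by
      have : 0 < ξ := by linarith
      positivity
    linarith [hDl ξ h]
  have hyr : ∀ ξ : ℝ, r ^ 2 + 1 / r ≤ ξ → r ≤ √ξ := fun ξ h => by
    apply Real.le_sqrt_of_sq_le; linarith
  have hbd : ∀ ξ : ℝ, r ^ 2 + 1 / r ≤ ξ → √ξ / |3 * ξ ^ 2 + (-3 * r ^ 4)| ≤ 1 / 3 := by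
    intro ξ h
    have h1 := hDl ξ h
    have h2 := hyr ξ h
    have h0 : 0 < ξ - r ^ 2 := by linarith
    have hξ0 : 0 < ξ := by have := pow_pos hr0 2; linarith
    rw [abs_of_pos (hDp ξ h), div_le_div_iff₀ (hDp ξ h) (by norm_num)]
    have hyy : ξ = √ξ ^ 2 := (Real.sq_sqrt hξ0.le).symm
    have h3 : 1 ≤ (ξ - r ^ 2) * √ξ := by
      have : 1 / r * r ≤ (ξ - r ^ 2) * √ξ := by gcongr; linarith
      rwa [one_div_mul_cancel hr0.ne'] at this
    have h4 : √ξ ≤ (ξ - r ^ 2) * ξ := by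
      calc √ξ = 1 * √ξ := by ring
        _ ≤ ((ξ - r ^ 2) * √ξ) * √ξ := by gcongr
        _ = (ξ - r ^ 2) * √ξ ^ 2 := by ring
        _ = _ := by rw [← hyy]
    linarith
  have H := oscE_ibp w hw (-3 * r ^ 4) a b (r ^ 2) ((‖w‖ + 2) / 3 * (1 / r)) 0
    (by have := pow_pos hr0 2; linarith) hab
    (fun ξ h => by have := h.1; have : 0 < ξ - r ^ 2 := by linarith
                   exact this.ne')
    (fun ξ h => (hDp ξ (ha.trans h.1)).ne') ?_
  · refine H.trans ?_
    have h1 := hbd a ha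
    have h2 := hbd b (ha.trans hab)
    have h3 : (1 / r) * (1 / (a - r ^ 2) - 1 / (b - r ^ 2)) ≤ 1 := by
      have h4 : 0 < b - r ^ 2 := by linarith
      have h5 : 0 ≤ 1 / (b - r ^ 2) := by positivity
      have h6 : 0 < a - r ^ 2 := by linarith
      have : 1 / r * (1 / (a - r ^ 2)) ≤ 1 := by
        rw [mul_one_div, div_le_one h6]; linarith
      nlinarith
    have h4 : (‖w‖ + 2) / 3 * (1 / r) * (1 / (a - r ^ 2) - 1 / (b - r ^ 2)) ≤ (‖w‖ + 2) / 3 := by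
      rw [mul_assoc]
      exact mul_le_of_le_one_right (by positivity) h3
    linarith
  · intro ξ h
    have hξ : r ^ 2 + 1 / r ≤ ξ := ha.trans h.1
    have h1 := hDl ξ hξ
    have hD0 := hDp ξ hξ
    have h2 := hyr ξ hξ
    have hs0 : 0 < ξ - r ^ 2 := by linarith
    have hξ0 : 0 < ξ := by have := pow_pos hr0 2; linarith
    set D := 3 * ξ ^ 2 + (-3 * r ^ 4)
    set y := √ξ with hy
    have hyy : ξ = y ^ 2 := (Real.sq_sqrt hξ0.le).symm
    have hsy : ξ - r ^ 2 ≤ y ^ 2 := by rw [← hyy]; nlinarith [pow_pos hr0 2]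
    set s := ξ - r ^ 2
    have hy0 : 0 < y := by linarith
    rw [abs_of_pos hD0, hyy, add_zero, mul_add]
    rw [hyy] at h1
    have e1 : y * (‖w‖ / (y ^ 2 * D)) ≤ ‖w‖ / (3 * r * s ^ 2) := by
      rw [mul_div_assoc', div_le_div_iff₀ (by positivity) (by positivity)]
      have : y * (3 * r * s ^ 2) ≤ y ^ 2 * D := by
        calc y * (3 * r * s ^ 2) ≤ y * (3 * y * (s * y ^ 2)) := by
              rw [sq s]; gcongr
          _ = y ^ 2 * (3 * s * y ^ 2) := by ring
          _ ≤ _ := by gcongr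
      nlinarith
    have e2 : y * (6 * y ^ 2 / D ^ 2) ≤ 2 / (3 * r * s ^ 2) := by
      rw [mul_div_assoc', div_le_div_iff₀ (by positivity) (by positivity)]
      calc y * (6 * y ^ 2) * (3 * r * s ^ 2) ≤ y * (6 * y ^ 2) * (3 * y * s ^ 2) := by gcongr
        _ = 2 * (3 * s * y ^ 2) ^ 2 := by ring
        _ ≤ _ := by gcongr
    calc _ ≤ ‖w‖ / (3 * r * s ^ 2) + 2 / (3 * r * s ^ 2) := add_le_add e1 e2
      _ = _ := by field_simp

lemma osc_caseB_left (w : ℂ) (hw : w.re = 1 / 2) (r a b : ℝ) (hr : 1 ≤ r) (ha : 1 / 2 ≤ a)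
    (hab : a ≤ b) (hb : b ≤ r ^ 2 - 1 / r) :
    ‖∫ ξ in a..b, oscE w 1 (-3 * r ^ 4) ξ‖ ≤ 2 + 2 * ‖w‖ := by
  have hW : 0 ≤ ‖w‖ := norm_nonneg w
  have hr0 : 0 < r := by linarith
  have hr1 : 0 < 1 / r := by positivity
  have hDl : ∀ ξ : ℝ, 0 < ξ → ξ ≤ r ^ 2 - 1 / r →
      3 * (r ^ 2 - ξ) * r ^ 2 ≤ |3 * ξ ^ 2 + (-3 * r ^ 4)| := fun ξ h0 h => by
    have : 0 < r ^ 2 - ξ := by linarith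
    have h2 : 0 < r ^ 2 := by positivity
    have : 3 * ξ ^ 2 + (-3 * r ^ 4) = - (3 * (r ^ 2 - ξ) * (ξ + r ^ 2)) := by ring
    rw [this, abs_neg, abs_of_pos (by positivity)]
    gcongr; linarith
  have hDp : ∀ ξ : ℝ, 0 < ξ → ξ ≤ r ^ 2 - 1 / r → 0 < |3 * ξ ^ 2 + (-3 * r ^ 4)| := fun ξ h0 h => by
    have h0 : 0 < r ^ 2 - ξ := by linarith
    have : 0 < 3 * (r ^ 2 - ξ) * r ^ 2 := by positivity
    linarith [hDl ξ ‹_› h]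
  have hyr : ∀ ξ : ℝ, ξ ≤ r ^ 2 - 1 / r → √ξ ≤ r := fun ξ h => by
    rw [Real.sqrt_le_left hr0.le]; linarith
  have hbd : ∀ ξ : ℝ, 0 < ξ → ξ ≤ r ^ 2 - 1 / r → √ξ / |3 * ξ ^ 2 + (-3 * r ^ 4)| ≤ 1 / 3 := by
    intro ξ h0 h
    have h1 := hDl ξ h0 h
    have h2 := hyr ξ h
    rw [div_le_div_iff₀ (hDp ξ h0 h) (by norm_num)]
    have : r ≤ (r ^ 2 - ξ) * r ^ 2 := by
      calc r = 1 / r * r ^ 2 := by field_simp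
        _ ≤ _ := by gcongr; linarith
    linarith
  have H := oscE_ibp w hw (-3 * r ^ 4) a b (r ^ 2) ((‖w‖ + 2) / 3 * (1 / r)) (2 * ‖w‖ / (3 * r ^ 2))
    (by linarith) hab
    (fun ξ h => by have := h.2; have : ξ - r ^ 2 < 0 := by linarith
                   exact this.ne)
    (fun ξ h => abs_pos.1 (hDp ξ (by linarith [h.1]) (h.2.trans hb))) ?_
  · refine H.trans ?_
    have h1 := hbd a (by linarith) (hab.trans hb)
    have h2 := hbd b (by linarith) hb
    have h3 : (1 / r) * (1 / (a - r ^ 2) - 1 / (b - r ^ 2)) ≤ 1 := by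
      have h4 : 0 < r ^ 2 - b := by linarith
      have h5 : 0 < r ^ 2 - a := by linarith
      have h6 : 0 ≤ 1 / (r ^ 2 - a) := by positivity
      have h7 : 1 / r * (1 / (r ^ 2 - b)) ≤ 1 := by
        rw [mul_one_div, div_le_one h4]; linarith
      rw [← neg_sub (r ^ 2) a, ← neg_sub (r ^ 2) b, one_div_neg_eq_neg_one_div,
        one_div_neg_eq_neg_one_div]
      nlinarith
    have h4 : (‖w‖ + 2) / 3 * (1 / r) * (1 / (a - r ^ 2) - 1 / (b - r ^ 2)) ≤ (‖w‖ + 2) / 3 := by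
      rw [mul_assoc]
      exact mul_le_of_le_one_right (by positivity) h3
    have h5 : 2 * ‖w‖ / (3 * r ^ 2) * (b - a) ≤ 2 * ‖w‖ / 3 := by
      calc 2 * ‖w‖ / (3 * r ^ 2) * (b - a) ≤ 2 * ‖w‖ / (3 * r ^ 2) * r ^ 2 := by gcongr; linarith
        _ = _ := by field_simp
    linarith
  · intro ξ h
    have hξ : ξ ≤ r ^ 2 - 1 / r := h.2.trans hb
    have hξ0 : 0 < ξ := by linarith [h.1]
    have hξ2 : 1 / 2 ≤ ξ := by linarith [h.1]
    have h1 := hDl ξ hξ0 hξ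
    have hD0 := hDp ξ hξ0 hξ
    have h2 := hyr ξ hξ
    have hs0 : 0 < r ^ 2 - ξ := by linarith
    rw [← sq_abs (3 * ξ ^ 2 + (-3 * r ^ 4)), ← neg_sub (r ^ 2) ξ, neg_sq]
    set D := |3 * ξ ^ 2 + (-3 * r ^ 4)|
    set y := √ξ with hy
    have hyy : ξ = y ^ 2 := (Real.sq_sqrt hξ0.le).symm
    set s := r ^ 2 - ξ with hs
    have hsr : s ≤ r ^ 2 := by linarith
    have hy0 : 0 < y := Real.sqrt_pos.2 hξ0
    have hy1 : 1 / 2 ≤ y := by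
      by_contra hcon
      push Not at hcon
      nlinarith
    have hsk : r ^ 2 = s + y ^ 2 := by rw [← hyy, hs]; ring
    rw [hyy, mul_add]
    have e1 : y * (‖w‖ / (y ^ 2 * D)) ≤ ‖w‖ / (3 * r * s ^ 2) + 2 * ‖w‖ / (3 * r ^ 2) := by
      have i1 : y * (‖w‖ / (y ^ 2 * D)) ≤ ‖w‖ / 3 * (1 / (y * (s * r ^ 2))) := by
        rw [mul_div_assoc', mul_one_div, div_div, div_le_div_iff₀ (by positivity) (by positivity)]
        have : y * (3 * (y * (s * r ^ 2))) ≤ y ^ 2 * D := by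
          calc _ = y ^ 2 * (3 * s * r ^ 2) := by ring
            _ ≤ _ := by gcongr
        nlinarith
      have i2 : 1 / (y * (s * r ^ 2)) ≤ 1 / (r * s ^ 2) + 2 / r ^ 2 := by
        have i3 : 1 / (y * (s * r ^ 2)) ≤ 1 / (r * s ^ 2) + 1 / (r ^ 4 * y) := by
          rw [div_add_div _ _ (by positivity) (by positivity), div_le_div_iff₀ (by positivity) (by positivity)]
          -- s r^2 ≤ s^2 + r^3 y, after clearing
          have j1 : s * r ^ 2 ≤ s ^ 2 + r ^ 3 * y := by
            have : s * y ^ 2 ≤ r ^ 2 * (r * y) := by rw [sq y]; gcongr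
            calc s * r ^ 2 = s ^ 2 + s * y ^ 2 := by rw [hsk]; ring
              _ ≤ _ := by linarith
          calc 1 * (r * s ^ 2 * (r ^ 4 * y)) = (s * r ^ 2) * (r ^ 3 * y * s) := by ring
            _ ≤ (s ^ 2 + r ^ 3 * y) * (r ^ 3 * y * s) := by gcongr
            _ = _ := by ring
        have i4 : 1 / (r ^ 4 * y) ≤ 2 / r ^ 2 := by
          rw [div_le_div_iff₀ (by positivity) (by positivity)]
          have : r ^ 2 ≤ r ^ 4 := pow_le_pow_right₀ hr (by norm_num)
          nlinarith [pow_pos hr0 4]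
        linarith
      calc _ ≤ _ := i1
        _ ≤ ‖w‖ / 3 * (1 / (r * s ^ 2) + 2 / r ^ 2) := by gcongr
        _ = _ := by field_simp
    have e2 : y * (6 * y ^ 2 / D ^ 2) ≤ 2 / (3 * r * s ^ 2) := by
      rw [mul_div_assoc', div_le_div_iff₀ (by positivity) (by positivity)]
      calc y * (6 * y ^ 2) * (3 * r * s ^ 2) ≤ r * (6 * r ^ 2) * (3 * r * s ^ 2) := by gcongr
        _ = 2 * (3 * s * r ^ 2) ^ 2 := by ring
        _ ≤ _ := by gcongr
    calc _ ≤ (‖w‖ / (3 * r * s ^ 2) + 2 * ‖w‖ / (3 * r ^ 2)) + 2 / (3 * r * s ^ 2) := add_le_add e1 e2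
      _ = _ := by field_simp; ring

lemma osc_core (w : ℂ) (hw : w.re = 1 / 2) (c N : ℝ) (hN : 0 ≤ N) :
    ‖∫ ξ in (0:ℝ)..N, oscE w 1 c ξ‖ ≤ 10 * (1 + ‖w‖) := by
  have hW : 0 ≤ ‖w‖ := norm_nonneg w
  have hi := oscE_intervalIntegrable w hw 1 c
  by_cases hc : -3 ≤ c
  · rw [← intervalIntegral.integral_add_adjacent_intervals (hi 0 (min N 2)) (hi (min N 2) N)]
    refine (norm_add_le _ _).trans ?_
    have h1 := oscE_triv w hw 1 c 0 (min N 2) le_rfl (le_min hN (by norm_num))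
    have h1' : √(min N 2) * (min N 2 - 0) ≤ 4 := by
      have h3 : min N 2 ≤ 2 := min_le_right _ _
      have h4 : 0 ≤ min N 2 := le_min hN (by norm_num)
      have : √(min N 2) ≤ 2 := by rw [Real.sqrt_le_left (by norm_num)]; linarith
      nlinarith [Real.sqrt_nonneg (min N 2)]
    have h2 : ‖∫ ξ in (min N 2)..N, oscE w 1 c ξ‖ ≤ 4 + ‖w‖ := by
      rcases le_total N 2 with h | h
      · rw [min_eq_left h]; simp; linarith
      · rw [min_eq_right h]
        exact osc_caseA w hw c 2 N hc le_rfl h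
    linarith
  · push Not at hc
    obtain ⟨r, hr, rfl⟩ : ∃ r : ℝ, 1 ≤ r ∧ c = -3 * r ^ 4 := by
      refine ⟨√√(-c / 3), ?_, ?_⟩
      · rw [Real.one_le_sqrt, Real.one_le_sqrt]; linarith
      · rw [show (4:ℕ) = 2 * 2 by norm_num, pow_mul, Real.sq_sqrt (Real.sqrt_nonneg _),
          Real.sq_sqrt (by linarith)]; ring
    have hr0 : 0 < r := by linarith
    have hr1 : 1 / r ≤ 1 := by rw [div_le_one hr0]; exact hr
    have hr2 : 0 < 1 / r := by positivity
    set m1 := min N (1 / 2) with hm1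
    set m2 := min N (max (1 / 2) (r ^ 2 - 1 / r)) with hm2
    set m3 := min N (r ^ 2 + 1 / r) with hm3
    have hrr : 1 ≤ r ^ 2 := by nlinarith
    have o1 : 0 ≤ m1 := le_min hN (by norm_num)
    have o2 : m1 ≤ m2 := min_le_min_left _ (le_max_left _ _)
    have o3 : m2 ≤ m3 := min_le_min_left _ (max_le (by linarith) (by linarith))
    rw [← intervalIntegral.integral_add_adjacent_intervals (hi 0 m3) (hi m3 N),
      ← intervalIntegral.integral_add_adjacent_intervals (hi 0 m2) (hi m2 m3),
      ← intervalIntegral.integral_add_adjacent_intervals (hi 0 m1) (hi m1 m2)]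
    have p1 : ‖∫ ξ in (0:ℝ)..m1, oscE w 1 (-3 * r ^ 4) ξ‖ ≤ 1 := by
      refine (oscE_triv w hw 1 _ 0 m1 le_rfl o1).trans ?_
      have h3 : m1 ≤ 1 / 2 := min_le_right _ _
      have : √m1 ≤ 1 := by rw [Real.sqrt_le_left (by norm_num)]; linarith
      nlinarith [Real.sqrt_nonneg m1]
    have p2 : ‖∫ ξ in m1..m2, oscE w 1 (-3 * r ^ 4) ξ‖ ≤ 2 + 2 * ‖w‖ := by
      rcases le_total N (1 / 2) with h | h
      · have e1 : m1 = N := min_eq_left h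
        have e2 : m2 = N := min_eq_left (h.trans (le_max_left _ _))
        rw [e1, e2]; simp; linarith
      rcases le_total (r ^ 2 - 1 / r) (1 / 2) with h' | h'
      · have : m1 = m2 := by rw [hm1, hm2, max_eq_left h']
        rw [this]; simp; linarith
      · refine osc_caseB_left w hw r m1 m2 hr (le_of_eq (min_eq_right h).symm) o2 ?_
        exact (min_le_right _ _).trans (le_of_eq (max_eq_right h'))
    have p3 : ‖∫ ξ in m2..m3, oscE w 1 (-3 * r ^ 4) ξ‖ ≤ 4 := by
      refine (oscE_triv w hw 1 _ m2 m3 (o1.trans o2) o3).trans ?_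
      have h3 : m3 ≤ r ^ 2 + 1 / r := min_le_right _ _
      have h4 : √m3 ≤ 2 * r := by rw [Real.sqrt_le_left (by linarith)]; nlinarith
      have h5 : m3 - m2 ≤ 2 * (1 / r) := by
        rcases le_total N (max (1 / 2) (r ^ 2 - 1 / r)) with h | h
        · have : m2 = N := min_eq_left h
          have : m3 ≤ N := min_le_left _ _
          linarith
        · have : m2 = max (1 / 2) (r ^ 2 - 1 / r) := min_eq_right h
          have : r ^ 2 - 1 / r ≤ m2 := by rw [this]; exact le_max_right _ _
          linarith
      calc √m3 * (m3 - m2) ≤ (2 * r) * (2 * (1 / r)) := by gcongr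
        _ = 4 := by field_simp; norm_num
    have p4 : ‖∫ ξ in m3..N, oscE w 1 (-3 * r ^ 4) ξ‖ ≤ 2 + ‖w‖ := by
      rcases le_total N (r ^ 2 + 1 / r) with h | h
      · have e1 : m3 = N := min_eq_left h
        rw [e1]; simp; linarith
      · exact osc_caseB_right w hw r m3 N hr (le_of_eq (min_eq_right h).symm) (min_le_left _ _)
    refine (norm_add_le _ _).trans ?_
    refine (add_le_add_left (norm_add_le _ _) _).trans ?_
    have := norm_add_le (∫ ξ in (0:ℝ)..m1, oscE w 1 (-3 * r ^ 4) ξ) (∫ ξ in m1..m2, oscE w 1 (-3 * r ^ 4) ξ)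
    linarith


lemma oscE_neg (w : ℂ) (τ y ξ : ℝ) : oscE w τ y (-ξ) = oscE w (-τ) (-y) ξ := by
  unfold oscE
  rw [Real.log_neg_eq_log]
  congr 3
  push_cast; ring

lemma oscE_conj (w : ℂ) (τ y ξ : ℝ) :
    (starRingEnd ℂ) (oscE w τ y ξ) = oscE ((starRingEnd ℂ) w) (-τ) (-y) ξ := by
  unfold oscE
  rw [← Complex.exp_conj]
  congr 1
  simp only [map_add, map_mul, Complex.conj_ofReal, Complex.conj_I]
  push_cast; ring

lemma osc_pos (w : ℂ) (hw : w.re = 1 / 2) (τ y N : ℝ) (hτ : 0 < τ) (hN : 0 ≤ N) :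
    ‖∫ ξ in (0:ℝ)..N, oscE w τ y ξ‖ ≤ 10 * (1 + ‖w‖) * τ ^ (-(1 / 2) : ℝ) := by
  set σ : ℝ := τ ^ (1 / 3 : ℝ) with hσ
  have hσ0 : 0 < σ := Real.rpow_pos_of_pos hτ _
  have hσ3 : σ ^ 3 = τ := by
    rw [hσ, ← Real.rpow_natCast, ← Real.rpow_mul hτ.le]; norm_num
  have h1 : ∫ ξ in (0:ℝ)..N, oscE w τ y ξ =
      ∫ ξ in (0:ℝ)..N, Complex.exp (-w * (Real.log σ : ℂ)) * oscE w 1 (y / σ) (σ * ξ) := by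
    apply intervalIntegral.integral_congr_ae
    refine Filter.Eventually.of_forall fun ξ hξ => ?_
    rw [uIoc_of_le hN] at hξ
    have hξ0 : 0 < ξ := hξ.1
    unfold oscE
    rw [← Complex.exp_add, Real.log_mul hσ0.ne' hξ0.ne']
    congr 1
    have : 1 * (σ * ξ) ^ 3 + y / σ * (σ * ξ) = τ * ξ ^ 3 + y * ξ := by
      rw [← hσ3]; field_simp
    rw [this]
    push_cast; ring
  rw [h1, intervalIntegral.integral_const_mul, intervalIntegral.integral_comp_mul_left _ hσ0.ne',
    norm_mul, norm_smul, mul_zero, Complex.norm_exp]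
  have h2 := osc_core w hw (y / σ) (σ * N) (by positivity)
  have h3 : (-w * (Real.log σ : ℂ)).re = Real.log σ * (-(1/2)) := by
    rw [Complex.re_mul_ofReal, Complex.neg_re, hw]; ring
  rw [h3, ← Real.rpow_def_of_pos hσ0, norm_inv, Real.norm_of_nonneg hσ0.le]
  have h4 : σ ^ (-(1/2) : ℝ) * σ⁻¹ = τ ^ (-(1 / 2) : ℝ) := by
    rw [← Real.rpow_neg_one, ← Real.rpow_add hσ0, hσ, ← Real.rpow_mul hτ.le]; norm_num
  rw [← mul_assoc, h4, mul_comm]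
  gcongr

lemma osc_half (w : ℂ) (hw : w.re = 1 / 2) (τ y N : ℝ) (hτ : τ ≠ 0) (hN : 0 ≤ N) :
    ‖∫ ξ in (0:ℝ)..N, oscE w τ y ξ‖ ≤ 10 * (1 + ‖w‖) * |τ| ^ (-(1 / 2) : ℝ) := by
  rcases lt_or_gt_of_ne hτ with h | h
  · have := osc_pos ((starRingEnd ℂ) w) (by simpa using hw) (-τ) (-y) N (by linarith) hN
    have e : ∫ ξ in (0:ℝ)..N, oscE ((starRingEnd ℂ) w) (-τ) (-y) ξ =
        (starRingEnd ℂ) (∫ ξ in (0:ℝ)..N, oscE w τ y ξ) := by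
      rw [← intervalIntegral.intervalIntegral_conj]
      simp only [oscE_conj]
    rw [e, RCLike.norm_conj, RCLike.norm_conj] at this
    rwa [abs_of_neg h]
  · rw [abs_of_pos h]; exact osc_pos w hw τ y N h hN

lemma osc_full (w : ℂ) (hw : w.re = 1 / 2) (τ y N : ℝ) (hτ : τ ≠ 0) (hN : 0 ≤ N) :
    ‖∫ ξ in Icc (-N) N, oscE w τ y ξ‖ ≤ 20 * (1 + ‖w‖) * |τ| ^ (-(1 / 2) : ℝ) := by
  rw [integral_Icc_eq_integral_Ioc, ← intervalIntegral.integral_of_le (by linarith),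
    ← intervalIntegral.integral_add_adjacent_intervals (b := 0)
      (oscE_intervalIntegrable w hw τ y _ _) (oscE_intervalIntegrable w hw τ y _ _)]
  have e : ∫ ξ in (-N)..0, oscE w τ y ξ = ∫ ξ in (0:ℝ)..N, oscE w (-τ) (-y) ξ := by
    rw [← neg_zero, ← intervalIntegral.integral_comp_neg]
    simp only [oscE_neg, neg_zero]
  rw [e]
  have h1 := osc_half w hw τ y N hτ hN
  have h2 := osc_half w hw (-τ) (-y) N (neg_ne_zero.2 hτ) hN
  rw [abs_neg] at h2
  refine (norm_add_le _ _).trans ?_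
  linarith


section fourier
open FourierTransform SchwartzMap

/-- Euclidean model of the plane. -/
abbrev E2 := WithLp 2 (ℝ × ℝ)

lemma plancherel_E (f : E2 → ℂ) (h1 : Integrable f) (h2 : MemLp f 2) :
    eLpNorm (𝓕 f) 2 volume = eLpNorm f 2 volume := by
  set F : Lp ℂ 2 (volume : Measure E2) := h2.toLp f with hF
  set G : Lp ℂ 2 (volume : Measure E2) := 𝓕 F with hG
  have hc : Continuous (𝓕 f) :=
    VectorFourier.fourierIntegral_continuous Real.continuous_fourierChar
      (L := innerₗ E2) continuous_inner h1
  have key : ∀ ψ : 𝓢(E2, ℂ), ∫ x, ψ x • 𝓕 f x = ∫ x, ψ x • G x := by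
    intro ψ
    have e1 := congrArg (fun T : 𝓢'(E2, ℂ) => T ψ) (Lp.fourier_toTemperedDistribution_eq F)
    simp only [TemperedDistribution.fourier_apply] at e1
    rw [Lp.toTemperedDistribution_apply, Lp.toTemperedDistribution_apply] at e1
    rw [← hG] at e1
    rw [← e1]
    have e2 : ∫ x, (𝓕 ψ) x • F x = ∫ x, (𝓕 ψ) x • f x := by
      apply integral_congr_ae
      filter_upwards [h2.coeFn_toLp] with x hx
      rw [hx]
    rw [e2]
    have := VectorFourier.integral_fourierIntegral_smul_eq_flip (L := innerₗ E2)
      Real.continuous_fourierChar continuous_inner (ψ.integrable (μ := volume)) h1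
    symm
    simpa using! this
  have hae : ∀ᵐ x, 𝓕 f x - G x = 0 := by
    apply ae_eq_zero_of_integral_contDiff_smul_eq_zero
    · exact hc.locallyIntegrable.sub ((Lp.memLp G).locallyIntegrable (by norm_num))
    · intro g g_smooth g_cpt
      have hg₁ : HasCompactSupport (Complex.ofRealCLM ∘ g) := g_cpt.comp_left rfl
      have hg₂ : ContDiff ℝ (⊤ : ℕ∞) (Complex.ofRealCLM ∘ g) := by fun_prop
      have h := key (hg₁.toSchwartzMap hg₂)
      simp only [smul_sub]
      rw [integral_sub]
      · rw [sub_eq_zero]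
        simpa using h
      · exact hc.locallyIntegrable.integrable_smul_left_of_hasCompactSupport
          g_smooth.continuous g_cpt
      · exact ((Lp.memLp G).locallyIntegrable (by norm_num)).integrable_smul_left_of_hasCompactSupport
          g_smooth.continuous g_cpt
  have e3 : eLpNorm (𝓕 f) 2 volume = eLpNorm G 2 volume := by
    apply eLpNorm_congr_ae
    filter_upwards [hae] with x hx
    exact sub_eq_zero.1 hx
  have e4 : eLpNorm G 2 volume = eLpNorm F 2 volume := by
    have := Lp.norm_fourier_eq F
    rw [Lp.norm_def, Lp.norm_def, ENNReal.toReal_eq_toReal_iff' (Lp.eLpNorm_ne_top _)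
      (Lp.eLpNorm_ne_top _)] at this
    exact this
  rw [e3, e4]
  exact eLpNorm_congr_ae h2.coeFn_toLp

lemma FT2_eq (f : ℝ × ℝ → ℂ) (p : ℝ × ℝ) :
    FT2 f p = 𝓕 (fun v : E2 => f (WithLp.ofLp v)) (WithLp.toLp 2 p) := by
  rw [Real.fourier_eq', FT2,
    ← (WithLp.volume_preserving_ofLp ℝ ℝ).integral_comp
      (MeasurableEquiv.toLp 2 (ℝ × ℝ)).symm.measurableEmbedding]
  congr 1

lemma IFT2_eq_FT2 (f : ℝ × ℝ → ℂ) (p : ℝ × ℝ) : IFT2 f p = FT2 f (-p) := by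
  unfold IFT2 FT2
  congr 1
  ext v
  congr 3
  push_cast
  simp only [Prod.fst_neg, Prod.snd_neg]
  push_cast
  ring

lemma IFT2_eq (f : ℝ × ℝ → ℂ) (p : ℝ × ℝ) :
    IFT2 f p = 𝓕⁻ (fun v : E2 => f (WithLp.ofLp v)) (WithLp.toLp 2 p) := by
  rw [IFT2_eq_FT2, FT2_eq, Real.fourierInv_eq_fourier_neg]
  rfl

lemma FT2_continuous (f : ℝ × ℝ → ℂ) (hf : Integrable f) : Continuous (FT2 f) := by
  have h : Integrable (fun v : E2 => f (WithLp.ofLp v)) :=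
    ((WithLp.volume_preserving_ofLp ℝ ℝ).integrable_comp_emb
      (MeasurableEquiv.toLp 2 (ℝ × ℝ)).symm.measurableEmbedding).2 hf
  have hc : Continuous (𝓕 (fun v : E2 => f (WithLp.ofLp v))) :=
    VectorFourier.fourierIntegral_continuous Real.continuous_fourierChar
      (L := innerₗ E2) continuous_inner h
  have : FT2 f = (𝓕 (fun v : E2 => f (WithLp.ofLp v))) ∘ (fun p => WithLp.toLp 2 p) := by
    ext p; exact FT2_eq f p
  rw [this]
  exact hc.comp (WithLp.prod_continuous_toLp 2 ℝ ℝ)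

lemma FT2_plancherel (f : ℝ × ℝ → ℂ) (h1 : Integrable f) (h2 : MemLp f 2) :
    ∫⁻ p, (‖FT2 f p‖₊ : ℝ≥0∞) ^ (2:ℝ) = ∫⁻ p, (‖f p‖₊ : ℝ≥0∞) ^ (2:ℝ) := by
  have mp := WithLp.volume_preserving_ofLp ℝ ℝ
  have me := (MeasurableEquiv.toLp 2 (ℝ × ℝ)).symm.measurableEmbedding
  have h1' : Integrable (fun v : E2 => f (WithLp.ofLp v)) := (mp.integrable_comp_emb me).2 h1
  have h2' : MemLp (fun v : E2 => f (WithLp.ofLp v)) 2 := h2.comp_measurePreserving mp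
  have := plancherel_E _ h1' h2'
  rw [eLpNorm_eq_eLpNorm' (by norm_num) (by norm_num),
    eLpNorm_eq_eLpNorm' (by norm_num) (by norm_num)] at this
  have h3 := congrArg (fun x => x ^ (2:ℝ)) this
  simp only [eLpNorm', ← ENNReal.rpow_mul, ENNReal.toReal_ofNat] at h3
  norm_num at h3
  have e1 := mp.lintegral_comp_emb me (fun p => (‖FT2 f p‖ₑ : ℝ≥0∞) ^ (2:ℝ))
  have e2 := mp.lintegral_comp_emb me (fun p => (‖f p‖ₑ : ℝ≥0∞) ^ (2:ℝ))
  simp only [enorm_eq_nnnorm] at e1 e2 h3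
  rw [← e1, ← e2]
  simp only [FT2_eq]
  norm_num
  exact h3

lemma FT2_IFT2 (f : ℝ × ℝ → ℂ) (hc : Continuous f) (h1 : Integrable f)
    (h2 : Integrable (IFT2 f)) : FT2 (IFT2 f) = f := by
  have mp := WithLp.volume_preserving_ofLp ℝ ℝ
  have me := (MeasurableEquiv.toLp 2 (ℝ × ℝ)).symm.measurableEmbedding
  have h1' : Integrable (fun v : E2 => f (WithLp.ofLp v)) := (mp.integrable_comp_emb me).2 h1
  have h2' : Integrable (𝓕⁻ (fun v : E2 => f (WithLp.ofLp v))) := by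
    have := (mp.integrable_comp_emb me).2 h2
    refine this.congr (Filter.Eventually.of_forall fun v => ?_)
    simp only [Function.comp, IFT2_eq]
  have hc' : Continuous (fun v : E2 => f (WithLp.ofLp v)) :=
    hc.comp (WithLp.prod_continuous_ofLp 2 ℝ ℝ)
  have h3 : Integrable (𝓕 (fun v : E2 => f (WithLp.ofLp v))) := by
    have := h2'.comp_neg
    refine this.congr (Filter.Eventually.of_forall fun v => ?_)
    simp only [Real.fourierInv_eq_fourier_neg, neg_neg]
  have := hc'.fourier_fourierInv_eq h1' h3
  ext p
  rw [FT2_eq]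
  have e : (fun v : E2 => IFT2 f (WithLp.ofLp v)) = 𝓕⁻ (fun v : E2 => f (WithLp.ofLp v)) := by
    ext v; rw [IFT2_eq]
  rw [e, this]

lemma IFT2_plancherel (f : ℝ × ℝ → ℂ) (h1 : Integrable f) (h2 : MemLp f 2) :
    ∫⁻ p, (‖IFT2 f p‖₊ : ℝ≥0∞) ^ (2:ℝ) = ∫⁻ p, (‖f p‖₊ : ℝ≥0∞) ^ (2:ℝ) := by
  rw [← FT2_plancherel f h1 h2]
  simp only [IFT2_eq_FT2]
  exact (Measure.measurePreserving_neg (volume : Measure (ℝ × ℝ))).lintegral_comp_emb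
    (MeasurableEquiv.neg (ℝ × ℝ)).measurableEmbedding (fun p => (‖FT2 f p‖₊ : ℝ≥0∞) ^ (2:ℝ))

lemma IFT2_continuous (f : ℝ × ℝ → ℂ) (hf : Integrable f) : Continuous (IFT2 f) := by
  have : IFT2 f = fun p => FT2 f (-p) := by ext p; exact IFT2_eq_FT2 f p
  rw [this]; exact (FT2_continuous f hf).comp continuous_neg

end fourier


lemma exp_strip_bound (x L : ℝ) (h0 : 0 ≤ x) (h1 : x ≤ 1) : Real.exp (x * L) ≤ 1 + Real.exp L := by
  rcases le_total 0 L with h | h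
  · have : Real.exp (x * L) ≤ Real.exp L := Real.exp_le_exp.2 (by nlinarith)
    linarith
  · have : Real.exp (x * L) ≤ 1 := Real.exp_le_one_iff.2 (by nlinarith)
    linarith [Real.exp_pos L]

lemma abs_exp_strip_bound (δ x L : ℝ) (hδ : 0 < δ) (h0 : δ ≤ x) (h1 : x ≤ 1 - δ) :
    |L| * Real.exp (x * L) ≤ (1 + Real.exp L) / δ := by
  rw [le_div_iff₀ hδ]
  rcases le_total 0 L with h | h
  · rw [abs_of_nonneg h]
    have h2 : δ * L ≤ Real.exp (δ * L) := by linarith [Real.add_one_le_exp (δ * L)]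
    have h3 : Real.exp (x * L) * Real.exp (δ * L) ≤ Real.exp L := by
      rw [← Real.exp_add]; exact Real.exp_le_exp.2 (by nlinarith)
    nlinarith [Real.exp_pos (x * L)]
  · rw [abs_of_nonpos h]
    have h2 : -(δ * L) ≤ Real.exp (-(δ * L)) := by linarith [Real.add_one_le_exp (-(δ * L))]
    have h3 : Real.exp (x * L) * Real.exp (-(δ * L)) ≤ 1 := by
      rw [← Real.exp_add]; exact Real.exp_le_one_iff.2 (by nlinarith)
    nlinarith [Real.exp_pos (x * L), Real.exp_pos L]

section phi
variable {X : Type*} [MeasurableSpace X] {μ : Measure X}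

lemma phi_norm_le (W : X → ℂ) (Λ : X → ℝ) (z : ℂ) (h0 : 0 ≤ z.re) (h1 : z.re ≤ 1) (x : X) :
    ‖W x * Complex.exp (z * (Λ x : ℂ))‖ ≤ ‖W x‖ * (1 + Real.exp (Λ x)) := by
  rw [norm_mul, Complex.norm_exp, Complex.re_mul_ofReal]
  gcongr
  exact exp_strip_bound _ _ h0 h1

lemma phi_integrable (W : X → ℂ) (Λ : X → ℝ) (hW : AEStronglyMeasurable W μ) (hΛ : Measurable Λ)
    (hI : Integrable (fun x => ‖W x‖ * (1 + Real.exp (Λ x))) μ) (z : ℂ) (h0 : 0 ≤ z.re)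
    (h1 : z.re ≤ 1) : Integrable (fun x => W x * Complex.exp (z * (Λ x : ℂ))) μ := by
  refine hI.mono' ?_ (Filter.Eventually.of_forall fun x => phi_norm_le W Λ z h0 h1 x)
  exact hW.mul (by fun_prop : Measurable fun x => Complex.exp (z * (Λ x : ℂ))).aestronglyMeasurable

lemma phi_bdd (W : X → ℂ) (Λ : X → ℝ)
    (hI : Integrable (fun x => ‖W x‖ * (1 + Real.exp (Λ x))) μ) (z : ℂ) (h0 : 0 ≤ z.re)
    (h1 : z.re ≤ 1) : ‖∫ x, W x * Complex.exp (z * (Λ x : ℂ)) ∂μ‖ ≤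
      ∫ x, ‖W x‖ * (1 + Real.exp (Λ x)) ∂μ :=
  norm_integral_le_of_norm_le hI (Filter.Eventually.of_forall fun x => phi_norm_le W Λ z h0 h1 x)

lemma phi_diffContOnCl (W : X → ℂ) (Λ : X → ℝ) (hW : AEStronglyMeasurable W μ) (hΛ : Measurable Λ)
    (hI : Integrable (fun x => ‖W x‖ * (1 + Real.exp (Λ x))) μ) :
    DiffContOnCl ℂ (fun z : ℂ => ∫ x, W x * Complex.exp (z * (Λ x : ℂ)) ∂μ)
      (Complex.HadamardThreeLines.verticalStrip 0 1) := by
  have hmeas : ∀ z : ℂ, AEStronglyMeasurable (fun x => W x * Complex.exp (z * (Λ x : ℂ))) μ :=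
    fun z => hW.mul
      (by fun_prop : Measurable fun x => Complex.exp (z * (Λ x : ℂ))).aestronglyMeasurable
  constructor
  · intro z hz
    simp only [Complex.HadamardThreeLines.verticalStrip, mem_preimage, mem_Ioo] at hz
    obtain ⟨δ, hδ, hδ0, hδ1⟩ : ∃ δ : ℝ, 0 < δ ∧ 2 * δ ≤ z.re ∧ z.re ≤ 1 - 2 * δ :=
      ⟨min z.re (1 - z.re) / 2, by have := lt_min hz.1 (sub_pos.2 hz.2); linarith,
        by linarith [min_le_left z.re (1 - z.re)], by linarith [min_le_right z.re (1 - z.re)]⟩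
    have := hasDerivAt_integral_of_dominated_loc_of_deriv_le (μ := μ) (𝕜 := ℂ)
      (F := fun (z : ℂ) x => W x * Complex.exp (z * (Λ x : ℂ)))
      (F' := fun (z : ℂ) x => W x * (Complex.exp (z * (Λ x : ℂ)) * (Λ x : ℂ)))
      (x₀ := z) (s := Metric.ball z δ) (bound := fun x => ‖W x‖ * (1 + Real.exp (Λ x)) / δ)
      (Metric.ball_mem_nhds z hδ) (Filter.Eventually.of_forall hmeas)
      (phi_integrable W Λ hW hΛ hI z hz.1.le hz.2.le) ?_ ?_ (hI.div_const δ) ?_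
    · exact this.2.differentiableAt.differentiableWithinAt
    · exact hW.mul (by fun_prop : Measurable fun x =>
        Complex.exp (z * (Λ x : ℂ)) * (Λ x : ℂ)).aestronglyMeasurable
    · refine Filter.Eventually.of_forall fun x y hy => ?_
      have hy' : |y.re - z.re| < δ := by
        rw [← Complex.sub_re]
        exact (Complex.abs_re_le_norm _).trans_lt (mem_ball_iff_norm.1 hy)
      rw [abs_lt] at hy'
      rw [norm_mul, norm_mul, Complex.norm_exp, Complex.re_mul_ofReal, Complex.norm_real,
        Real.norm_eq_abs, mul_div_assoc]
      gcongr
      rw [mul_comm]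
      exact abs_exp_strip_bound δ _ _ hδ (by linarith) (by linarith)
    · refine Filter.Eventually.of_forall fun x y hy => ?_
      have : HasDerivAt (fun y : ℂ => y * (Λ x : ℂ)) (Λ x : ℂ) y := by
        simpa using (hasDerivAt_id y).mul_const (Λ x : ℂ)
      exact (this.cexp).const_mul _
  · have hcl : closure (Complex.HadamardThreeLines.verticalStrip 0 1) ⊆
        Complex.re ⁻¹' (Icc 0 1) := by
      apply closure_minimal
      · intro z hz; exact ⟨hz.1.le, hz.2.le⟩
      · exact isClosed_Icc.preimage Complex.continuous_re
    refine ContinuousOn.mono ?_ hcl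
    refine continuousOn_of_dominated (bound := fun x => ‖W x‖ * (1 + Real.exp (Λ x)))
      (fun z _ => hmeas z) ?_ hI ?_
    · intro z hz
      exact Filter.Eventually.of_forall fun x => phi_norm_le W Λ z hz.1 hz.2 x
    · exact Filter.Eventually.of_forall fun x => by fun_prop

/-- three lines with quadratic growth on the boundary -/
lemma phi_interp (W : X → ℂ) (Λ : X → ℝ) (hW : AEStronglyMeasurable W μ) (hΛ : Measurable Λ)
    (hI : Integrable (fun x => ‖W x‖ * (1 + Real.exp (Λ x))) μ) (A B θ : ℝ) (hθ0 : 0 ≤ θ)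
    (hθ1 : θ ≤ 1)
    (h0 : ∀ z : ℂ, z.re = 0 → ‖∫ x, W x * Complex.exp (z * (Λ x : ℂ)) ∂μ‖ ≤ A)
    (h1 : ∀ z : ℂ, z.re = 1 → ‖∫ x, W x * Complex.exp (z * (Λ x : ℂ)) ∂μ‖ ≤ B * (1 + ‖z / 2‖) ^ 2) :
    ‖∫ x, W x * Complex.exp ((θ : ℂ) * (Λ x : ℂ)) ∂μ‖ ≤ A ^ (1 - θ) * (20 * B) ^ θ := by
  set Φ : ℂ → ℂ := fun z : ℂ => ∫ x, W x * Complex.exp (z * (Λ x : ℂ)) ∂μ with hΦ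
  have hB : 0 ≤ B := by
    have := (norm_nonneg _).trans (h1 1 (by simp))
    by_contra h
    push Not at h
    have h3 : 0 < (1 + ‖(1:ℂ) / 2‖) ^ 2 := by positivity
    nlinarith
  have hn : ∀ z : ℂ, ‖Complex.exp (z ^ 2)‖ = Real.exp (z.re ^ 2 - z.im ^ 2) := by
    intro z; rw [Complex.norm_exp]; congr 1; rw [pow_two, Complex.mul_re]; ring
  have key := Complex.HadamardThreeLines.norm_le_interp_of_mem_verticalClosedStrip₀₁'
    (fun z => Complex.exp (z ^ 2) * Φ z) (z := (θ : ℂ)) (a := A) (b := 20 * B)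
    (by simp [Complex.HadamardThreeLines.verticalClosedStrip, hθ0, hθ1]) ?_ ?_ ?_ ?_
  · simp only [Complex.ofReal_re, norm_mul, hn, Complex.ofReal_im] at key
    refine le_trans ?_ key
    have : 1 ≤ Real.exp (θ ^ 2 - 0 ^ 2) := Real.one_le_exp (by nlinarith [sq_nonneg θ])
    exact le_mul_of_one_le_left (norm_nonneg _) this
  · have h : Differentiable ℂ (fun z : ℂ => Complex.exp (z ^ 2)) := by fun_prop
    exact (h.diffContOnCl).smul (phi_diffContOnCl W Λ hW hΛ hI)
  · refine ⟨Real.exp 1 * ∫ x, ‖W x‖ * (1 + Real.exp (Λ x)) ∂μ, ?_⟩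
    rintro _ ⟨z, hz, rfl⟩
    simp only [Function.comp, norm_mul, hn]
    have hz' : 0 ≤ z.re ∧ z.re ≤ 1 := hz
    refine mul_le_mul ?_ (phi_bdd W Λ hI z hz'.1 hz'.2) (norm_nonneg _) (Real.exp_pos _).le
    exact Real.exp_le_exp.2 (by nlinarith [sq_nonneg z.im])
  · intro z hz
    have hz' : z.re = 0 := hz
    rw [norm_mul, hn, hz']
    refine (mul_le_of_le_one_left (norm_nonneg _) ?_).trans (h0 z hz')
    exact Real.exp_le_one_iff.2 (by nlinarith [sq_nonneg z.im])
  · intro z hz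
    have hz' : z.re = 1 := hz
    rw [norm_mul, hn, hz']
    have g1 : ‖z / 2‖ ≤ (1 + |z.im|) / 2 := by
      rw [norm_div]; norm_num
      have := Complex.norm_le_abs_re_add_abs_im z
      rw [hz', abs_one] at this
      linarith
    have g2 : (1 + ‖z / 2‖) ^ 2 ≤ (18 / 4) * (1 + z.im ^ 2) := by
      have : (1 + ‖z / 2‖) ^ 2 ≤ (1 + (1 + |z.im|) / 2) ^ 2 := by gcongr
      nlinarith [sq_abs z.im, sq_nonneg (|z.im| - 1)]
    have g3 : Real.exp (1 ^ 2 - z.im ^ 2) * (1 + z.im ^ 2) ≤ 3 := by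
      have e1 : 1 + z.im ^ 2 ≤ Real.exp (z.im ^ 2) := by linarith [Real.add_one_le_exp (z.im ^ 2)]
      calc Real.exp (1 ^ 2 - z.im ^ 2) * (1 + z.im ^ 2)
          ≤ Real.exp (1 ^ 2 - z.im ^ 2) * Real.exp (z.im ^ 2) := by gcongr
        _ = Real.exp 1 := by rw [← Real.exp_add]; congr 1; ring
        _ ≤ 3 := by linarith [Real.exp_one_lt_d9]
    calc Real.exp (1 ^ 2 - z.im ^ 2) * ‖Φ z‖
        ≤ Real.exp (1 ^ 2 - z.im ^ 2) * (B * ((18 / 4) * (1 + z.im ^ 2))) := by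
          gcongr
          exact (h1 z hz').trans (by gcongr)
      _ = (Real.exp (1 ^ 2 - z.im ^ 2) * (1 + z.im ^ 2)) * (B * (18 / 4)) := by ring
      _ ≤ 3 * (B * (18 / 4)) := by gcongr
      _ ≤ 20 * B := by linarith

end phi


/-- frequency box -/
def QN (N : ℝ) : Set (ℝ × ℝ) := Icc (-N) N ×ˢ Icc (-N) N

/-- log weight -/
def lw (ζ : ℝ × ℝ) : ℝ := Real.log ζ.1 / 2 + Real.log ζ.2 / 2

lemma lw_measurable : Measurable lw := by unfold lw; fun_prop

/-- the phase of the group -/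
def ph (τ : ℝ) (ζ : ℝ × ℝ) : ℂ := Complex.exp (((τ * (ζ.1 ^ 3 + ζ.2 ^ 3) : ℝ) : ℂ) * Complex.I)

/-- the character -/
def ch (z ζ : ℝ × ℝ) : ℂ :=
  Complex.exp (((2 * Real.pi * (z.1 * ζ.1 + z.2 * ζ.2) : ℝ) : ℂ) * Complex.I)

/-- the conjugate character -/
def chm (z ζ : ℝ × ℝ) : ℂ :=
  Complex.exp (((-2 * Real.pi * (z.1 * ζ.1 + z.2 * ζ.2) : ℝ) : ℂ) * Complex.I)

lemma ph_norm (τ : ℝ) (ζ : ℝ × ℝ) : ‖ph τ ζ‖ = 1 := Complex.norm_exp_ofReal_mul_I _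
lemma ch_norm (z ζ : ℝ × ℝ) : ‖ch z ζ‖ = 1 := Complex.norm_exp_ofReal_mul_I _
lemma chm_norm (z ζ : ℝ × ℝ) : ‖chm z ζ‖ = 1 := Complex.norm_exp_ofReal_mul_I _

lemma QN_meas (N : ℝ) : MeasurableSet (QN N) := measurableSet_Icc.prod measurableSet_Icc

lemma QN_fin (N : ℝ) : volume (QN N) < ⊤ := by
  have : IsCompact (QN N) := isCompact_Icc.prod isCompact_Icc
  exact this.measure_lt_top

lemma exp_half_log_le (ξ : ℝ) : Real.exp (Real.log ξ / 2) ≤ 1 + √|ξ| := by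
  have := oscE_norm_le (1/2) (by norm_num) 0 0 ξ
  rwa [oscE_norm_exp (1/2) (by norm_num)] at this

lemma exp_lw_le (N : ℝ) (ζ : ℝ × ℝ) (h : ζ ∈ QN N) :
    Real.exp (lw ζ) ≤ (1 + √N) * (1 + √N) := by
  obtain ⟨h1, h2⟩ := h
  rw [lw, Real.exp_add]
  gcongr
  · refine (exp_half_log_le _).trans ?_
    gcongr
    exact abs_le.2 h1
  · refine (exp_half_log_le _).trans ?_
    gcongr
    exact abs_le.2 h2

lemma lw_integrable (N : ℝ) :
    Integrable (fun ζ => 1 + Real.exp (lw ζ)) (volume.restrict (QN N)) := by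
  have : IsFiniteMeasure (volume.restrict (QN N)) := ⟨by simpa using QN_fin N⟩
  refine Integrable.of_bound (C := 1 + (1 + √N) * (1 + √N))
    (by have := lw_measurable; fun_prop) ?_
  refine (ae_restrict_iff' (QN_meas N)).2 (Filter.Eventually.of_forall fun ζ hζ => ?_)
  rw [Real.norm_of_nonneg (by positivity)]
  linarith [exp_lw_le N ζ hζ]

lemma memLp_twist (a : ℝ × ℝ → ℂ) (α : ℝ × ℝ → ℝ) (hα : Measurable α) (h : MemLp a 2) (z : ℂ)
    (hz : z.re = 0) : MemLp (fun y => a y * Complex.exp (z * (α y : ℂ))) 2 := by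
  refine MemLp.of_le h (h.1.mul (by fun_prop : Measurable fun x =>
    Complex.exp (z * (α x : ℂ))).aestronglyMeasurable) (Filter.Eventually.of_forall fun y => ?_)
  rw [norm_mul, Complex.norm_exp, Complex.re_mul_ofReal, hz]
  simp

section stein

/-- amplitude -/
def Wst (a b : ℝ × ℝ → ℂ) (τ : ℝ) (x : (ℝ × ℝ) × ((ℝ × ℝ) × (ℝ × ℝ))) : ℂ :=
  ph τ x.1 * ((ch x.1 x.2.1 * a x.2.1) * (chm x.1 x.2.2 * b x.2.2))

/-- exponent -/
def Lst (α β : ℝ × ℝ → ℝ) (x : (ℝ × ℝ) × ((ℝ × ℝ) × (ℝ × ℝ))) : ℝ :=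
  lw x.1 + (α x.2.1 + β x.2.2)

lemma Lst_meas
    (α β : ℝ × ℝ → ℝ) (hα : Measurable α) (hβ : Measurable β) : Measurable (Lst α β) := by
  unfold Lst; have := lw_measurable; fun_prop

lemma Wst_meas
    (a b : ℝ × ℝ → ℂ) (ha2 : MemLp a 2) (hb2 : MemLp b 2)
    (τ N : ℝ) : AEStronglyMeasurable (Wst a b τ)
    ((volume.restrict (QN N)).prod (volume.prod volume)) := by
  have h1 : AEStronglyMeasurable (fun x : (ℝ × ℝ) × ((ℝ × ℝ) × (ℝ × ℝ)) => a x.2.1)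
      ((volume.restrict (QN N)).prod (volume.prod volume)) :=
    (ha2.1.comp_fst (ν := (volume : Measure (ℝ × ℝ)))).comp_snd
  have h2 : AEStronglyMeasurable (fun x : (ℝ × ℝ) × ((ℝ × ℝ) × (ℝ × ℝ)) => b x.2.2)
      ((volume.restrict (QN N)).prod (volume.prod volume)) :=
    (hb2.1.comp_snd (μ := (volume : Measure (ℝ × ℝ)))).comp_snd
  unfold Wst ph ch chm
  refine AEStronglyMeasurable.mul (Continuous.aestronglyMeasurable (by fun_prop)) ?_
  exact ((Continuous.aestronglyMeasurable (by fun_prop)).mul h1).mul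
    ((Continuous.aestronglyMeasurable (by fun_prop)).mul h2)

lemma WL_integrable
    (a b : ℝ × ℝ → ℂ) (α β : ℝ × ℝ → ℝ) (hα : Measurable α) (hβ : Measurable β)
    (ha : Integrable fun y => ‖a y‖ * (1 + Real.exp (α y)))
    (hb : Integrable fun y => ‖b y‖ * (1 + Real.exp (β y))) (ha2 : MemLp a 2) (hb2 : MemLp b 2)
    (τ N : ℝ) : Integrable (fun x => ‖Wst a b τ x‖ * (1 + Real.exp (Lst α β x)))
    ((volume.restrict (QN N)).prod (volume.prod volume)) := by
  refine ((lw_integrable N).mul_prod (ha.mul_prod hb)).mono' ?_ ?_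
  · have := Lst_meas α β hα hβ
    exact (Wst_meas a b ha2 hb2 τ N).norm.mul (by fun_prop : Measurable fun x =>
      (1 + Real.exp (Lst α β x))).aestronglyMeasurable
  · refine Filter.Eventually.of_forall fun x => ?_
    rw [Real.norm_of_nonneg (by positivity)]
    simp only [Wst, norm_mul, ph_norm, ch_norm, chm_norm, one_mul, Lst, Real.exp_add]
    have e1 := Real.exp_pos (lw x.1)
    have e2 := Real.exp_pos (α x.2.1)
    have e3 := Real.exp_pos (β x.2.2)
    calc ‖a x.2.1‖ * ‖b x.2.2‖ *
        (1 + Real.exp (lw x.1) * (Real.exp (α x.2.1) * Real.exp (β x.2.2))) ≤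
        ‖a x.2.1‖ * ‖b x.2.2‖ *
        ((1 + Real.exp (lw x.1)) * ((1 + Real.exp (α x.2.1)) * (1 + Real.exp (β x.2.2)))) := by
          gcongr
          nlinarith [mul_pos e1 e2, mul_pos e1 e3, mul_pos e2 e3]
      _ = _ := by ring

lemma Phi_eq1
    (a b : ℝ × ℝ → ℂ) (α β : ℝ × ℝ → ℝ) (hα : Measurable α) (hβ : Measurable β)
    (ha : Integrable fun y => ‖a y‖ * (1 + Real.exp (α y)))
    (hb : Integrable fun y => ‖b y‖ * (1 + Real.exp (β y))) (ha2 : MemLp a 2) (hb2 : MemLp b 2)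
    (τ N : ℝ) (z : ℂ) (h0 : 0 ≤ z.re) (h1 : z.re ≤ 1) :
    ∫ x, Wst a b τ x * Complex.exp (z * (Lst α β x : ℂ))
      ∂((volume.restrict (QN N)).prod (volume.prod volume)) =
    ∫ ζ in QN N, (ph τ ζ * Complex.exp (z * (lw ζ : ℂ))) *
      (IFT2 (fun y => a y * Complex.exp (z * (α y : ℂ))) ζ *
       FT2 (fun y => b y * Complex.exp (z * (β y : ℂ))) ζ) := by
  rw [integral_prod _ (phi_integrable _ _ (Wst_meas a b ha2 hb2 τ N) (Lst_meas α β hα hβ)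
    (WL_integrable a b α β hα hβ ha hb ha2 hb2 τ N) z h0 h1)]
  congr 1
  ext ζ
  rw [IFT2, FT2, ← integral_prod_mul, ← integral_const_mul]
  congr 1
  ext y
  simp only [Wst, Lst, ch, chm]
  push_cast
  simp only [mul_add, Complex.exp_add]
  ring

lemma Phi_eq2
    (a b : ℝ × ℝ → ℂ) (α β : ℝ × ℝ → ℝ) (hα : Measurable α) (hβ : Measurable β)
    (ha : Integrable fun y => ‖a y‖ * (1 + Real.exp (α y)))
    (hb : Integrable fun y => ‖b y‖ * (1 + Real.exp (β y))) (ha2 : MemLp a 2) (hb2 : MemLp b 2)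
    (τ N : ℝ) (z : ℂ) (h0 : 0 ≤ z.re) (h1 : z.re ≤ 1) :
    ∫ x, Wst a b τ x * Complex.exp (z * (Lst α β x : ℂ))
      ∂((volume.restrict (QN N)).prod (volume.prod volume)) =
    ∫ y : (ℝ × ℝ) × (ℝ × ℝ), ((a y.1 * Complex.exp (z * (α y.1 : ℂ))) *
        (b y.2 * Complex.exp (z * (β y.2 : ℂ)))) *
      ((∫ ξ in Icc (-N) N, oscE (z / 2) τ (2 * Real.pi * (y.1.1 - y.2.1)) ξ) *
       (∫ ξ in Icc (-N) N, oscE (z / 2) τ (2 * Real.pi * (y.1.2 - y.2.2)) ξ)) := by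
  rw [integral_prod_symm _ (phi_integrable _ _ (Wst_meas a b ha2 hb2 τ N) (Lst_meas α β hα hβ)
    (WL_integrable a b α β hα hβ ha hb ha2 hb2 τ N) z h0 h1)]
  congr 1
  ext y
  rw [← setIntegral_prod_mul, ← integral_const_mul]
  rw [QN]
  congr 1
  ext ζ
  simp only [Wst, Lst, ch, chm, ph, oscE, lw, ← Complex.exp_add]
  have k1 : ∀ A B C D : ℂ, Complex.exp A * (Complex.exp B * a y.1 * (Complex.exp C * b y.2)) *
    Complex.exp D = a y.1 * b y.2 * Complex.exp (A + B + C + D) := by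
    intros; simp only [Complex.exp_add]; ring
  have k2 : ∀ A B C : ℂ, (a y.1 * Complex.exp A * (b y.2 * Complex.exp B)) *
    Complex.exp C = a y.1 * b y.2 * Complex.exp (A + B + C) := by
    intros; simp only [Complex.exp_add]; ring
  rw [k1, k2]
  congr 2
  push_cast
  ring

lemma Phi_bd1
    (a b : ℝ × ℝ → ℂ) (α β : ℝ × ℝ → ℝ) (hα : Measurable α) (hβ : Measurable β)
    (ha : Integrable fun y => ‖a y‖ * (1 + Real.exp (α y)))
    (hb : Integrable fun y => ‖b y‖ * (1 + Real.exp (β y))) (ha2 : MemLp a 2) (hb2 : MemLp b 2)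
    (τ N : ℝ) (hτ : τ ≠ 0) (hN : 0 ≤ N) (A1 B1 : ℝ)
    (hA1 : ∫ y, ‖a y‖ * Real.exp (α y) ≤ A1) (hB1 : ∫ y, ‖b y‖ * Real.exp (β y) ≤ B1)
    (z : ℂ) (hz : z.re = 1) :
    ‖∫ x, Wst a b τ x * Complex.exp (z * (Lst α β x : ℂ))
      ∂((volume.restrict (QN N)).prod (volume.prod volume))‖ ≤
    (400 * |τ|⁻¹ * (A1 * B1)) * (1 + ‖z / 2‖) ^ 2 := by
  rw [Phi_eq2 a b α β hα hβ ha hb ha2 hb2 τ N z (by linarith) hz.le]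
  have hw : (z / 2).re = 1 / 2 := by
    rw [show z / 2 = z / ((2:ℝ):ℂ) by simp, Complex.div_ofReal_re, hz]
  have hI : ∀ (c : ℝ × ℝ → ℂ) (γ : ℝ × ℝ → ℝ), Measurable γ → AEStronglyMeasurable c volume →
      Integrable (fun y => ‖c y‖ * (1 + Real.exp (γ y))) →
      Integrable (fun y => ‖c y‖ * Real.exp (γ y)) := by
    intro c γ hγ hc h
    refine h.mono' (hc.norm.mul (by fun_prop : Measurable fun x =>
      Real.exp (γ x)).aestronglyMeasurable) (Filter.Eventually.of_forall fun y => ?_)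
    rw [Real.norm_of_nonneg (by positivity)]
    gcongr
    linarith
  have hIa := hI a α hα ha2.1 ha
  have hIb := hI b β hβ hb2.1 hb
  set K := 20 * (1 + ‖z / 2‖) * |τ| ^ (-(1 / 2) : ℝ) with hK
  have hK0 : 0 ≤ K := by positivity
  have hKK : K * K = 400 * |τ|⁻¹ * (1 + ‖z / 2‖) ^ 2 := by
    have : |τ| ^ (-(1 / 2) : ℝ) * |τ| ^ (-(1 / 2) : ℝ) = |τ|⁻¹ := by
      rw [← Real.rpow_add (abs_pos.2 hτ), ← Real.rpow_neg_one]; norm_num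
    rw [hK, ← this]; ring
  have step : ‖∫ y : (ℝ × ℝ) × (ℝ × ℝ), ((a y.1 * Complex.exp (z * (α y.1 : ℂ))) *
        (b y.2 * Complex.exp (z * (β y.2 : ℂ)))) *
      ((∫ ξ in Icc (-N) N, oscE (z / 2) τ (2 * Real.pi * (y.1.1 - y.2.1)) ξ) *
       (∫ ξ in Icc (-N) N, oscE (z / 2) τ (2 * Real.pi * (y.1.2 - y.2.2)) ξ))‖ ≤
      ∫ y : (ℝ × ℝ) × (ℝ × ℝ), ((‖a y.1‖ * Real.exp (α y.1)) * (‖b y.2‖ * Real.exp (β y.2)))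
        * (K * K) := by
    refine norm_integral_le_of_norm_le ((hIa.mul_prod hIb).mul_const _)
      (Filter.Eventually.of_forall fun y => ?_)
    simp only [norm_mul, Complex.norm_exp, Complex.re_mul_ofReal, hz, one_mul]
    gcongr
    · exact osc_full _ hw _ _ _ hτ hN
    · exact osc_full _ hw _ _ _ hτ hN
  refine step.trans ?_
  have e : ∫ y : (ℝ × ℝ) × (ℝ × ℝ), ((‖a y.1‖ * Real.exp (α y.1)) * (‖b y.2‖ * Real.exp (β y.2)))
        * (K * K) = (∫ y, ‖a y‖ * Real.exp (α y)) * (∫ y, ‖b y‖ * Real.exp (β y)) * (K * K) := by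
    rw [integral_mul_const, ← integral_prod_mul]
    rfl
  rw [e, hKK]
  have p1 : 0 ≤ ∫ y, ‖a y‖ * Real.exp (α y) := integral_nonneg fun y => by positivity
  have p2 : 0 ≤ ∫ y, ‖b y‖ * Real.exp (β y) := integral_nonneg fun y => by positivity
  calc _ ≤ A1 * B1 * (400 * |τ|⁻¹ * (1 + ‖z / 2‖) ^ 2) := by
        gcongr
        exact p1.trans hA1
    _ = _ := by ring

lemma Phi_bd0
    (a b : ℝ × ℝ → ℂ) (α β : ℝ × ℝ → ℝ) (hα : Measurable α) (hβ : Measurable β)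
    (ha : Integrable fun y => ‖a y‖ * (1 + Real.exp (α y)))
    (hb : Integrable fun y => ‖b y‖ * (1 + Real.exp (β y))) (ha2 : MemLp a 2) (hb2 : MemLp b 2)
    (τ N A0 B0 : ℝ) (hA0' : 0 ≤ A0) (hB0' : 0 ≤ B0)
    (hA0 : ∫⁻ y, (‖a y‖₊ : ℝ≥0∞) ^ (2:ℝ) ≤ ENNReal.ofReal A0)
    (hB0 : ∫⁻ y, (‖b y‖₊ : ℝ≥0∞) ^ (2:ℝ) ≤ ENNReal.ofReal B0)
    (z : ℂ) (hz : z.re = 0) :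
    ‖∫ x, Wst a b τ x * Complex.exp (z * (Lst α β x : ℂ))
      ∂((volume.restrict (QN N)).prod (volume.prod volume))‖ ≤ √A0 * √B0 := by
  rw [Phi_eq1 a b α β hα hβ ha hb ha2 hb2 τ N z hz.ge (by linarith)]
  have hI : ∀ (c : ℝ × ℝ → ℂ) (γ : ℝ × ℝ → ℝ), Measurable γ → AEStronglyMeasurable c volume →
      Integrable (fun y => ‖c y‖ * (1 + Real.exp (γ y))) →
      Integrable (fun y => c y * Complex.exp (z * (γ y : ℂ))) :=
    fun c γ hγ hc h => phi_integrable c γ hc hγ h z hz.ge (by linarith)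
  set F := IFT2 (fun y => a y * Complex.exp (z * (α y : ℂ))) with hF
  set G := FT2 (fun y => b y * Complex.exp (z * (β y : ℂ))) with hG
  have hFc : Continuous F := IFT2_continuous _ (hI a α hα ha2.1 ha)
  have hGc : Continuous G := FT2_continuous _ (hI b β hβ hb2.1 hb)
  have hn : ∀ (c : ℝ × ℝ → ℂ) (γ : ℝ × ℝ → ℝ) (y),
      ‖c y * Complex.exp (z * (γ y : ℂ))‖₊ = ‖c y‖₊ := by
    intro c γ y
    apply NNReal.eq
    rw [coe_nnnorm, coe_nnnorm, norm_mul, Complex.norm_exp, Complex.re_mul_ofReal, hz]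
    simp
  have hF2 : ∫⁻ p, (‖F p‖₊ : ℝ≥0∞) ^ (2:ℝ) ≤ ENNReal.ofReal A0 := by
    rw [hF, IFT2_plancherel _ (hI a α hα ha2.1 ha) (memLp_twist a α hα ha2 z hz)]
    simpa only [hn] using hA0
  have hG2 : ∫⁻ p, (‖G p‖₊ : ℝ≥0∞) ^ (2:ℝ) ≤ ENNReal.ofReal B0 := by
    rw [hG, FT2_plancherel _ (hI b β hβ hb2.1 hb) (memLp_twist b β hβ hb2 z hz)]
    simpa only [hn] using hB0
  have main : ‖∫ ζ in QN N, (ph τ ζ * Complex.exp (z * (lw ζ : ℂ))) * (F ζ * G ζ)‖ₑ ≤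
      ENNReal.ofReal (√A0 * √B0) := by
    refine (enorm_integral_le_lintegral_enorm _).trans ?_
    have e1 : ∀ ζ, ‖(ph τ ζ * Complex.exp (z * (lw ζ : ℂ))) * (F ζ * G ζ)‖ₑ =
        ((fun p => (‖F p‖₊ : ℝ≥0∞)) * (fun p => (‖G p‖₊ : ℝ≥0∞))) ζ := by
      intro ζ
      rw [enorm_eq_nnnorm, Pi.mul_apply, ← ENNReal.coe_mul]
      congr 1
      apply NNReal.eq
      simp [ph_norm, Complex.norm_exp, Complex.re_mul_ofReal, hz]
    simp only [e1]
    refine (setLIntegral_le_lintegral _ _).trans ?_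
    refine (ENNReal.lintegral_mul_le_Lp_mul_Lq volume Real.HolderConjugate.two_two
      (by have := hFc.measurable; fun_prop) (by have := hGc.measurable; fun_prop)).trans ?_
    rw [ENNReal.ofReal_mul (Real.sqrt_nonneg _), Real.sqrt_eq_rpow, Real.sqrt_eq_rpow,
      ← ENNReal.ofReal_rpow_of_nonneg hA0' (by norm_num),
      ← ENNReal.ofReal_rpow_of_nonneg hB0' (by norm_num)]
    gcongr
  rw [← ofReal_norm_eq_enorm] at main
  exact (ENNReal.ofReal_le_ofReal_iff (by positivity)).1 main

lemma stein
    (a b : ℝ × ℝ → ℂ) (α β : ℝ × ℝ → ℝ) (hα : Measurable α) (hβ : Measurable β)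
    (ha : Integrable fun y => ‖a y‖ * (1 + Real.exp (α y)))
    (hb : Integrable fun y => ‖b y‖ * (1 + Real.exp (β y))) (ha2 : MemLp a 2) (hb2 : MemLp b 2)
    (τ N A0 B0 A1 B1 θ : ℝ) (hτ : τ ≠ 0) (hN : 0 ≤ N) (hA0' : 0 ≤ A0) (hB0' : 0 ≤ B0)
    (hA0 : ∫⁻ y, (‖a y‖₊ : ℝ≥0∞) ^ (2:ℝ) ≤ ENNReal.ofReal A0)
    (hB0 : ∫⁻ y, (‖b y‖₊ : ℝ≥0∞) ^ (2:ℝ) ≤ ENNReal.ofReal B0)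
    (hA1 : ∫ y, ‖a y‖ * Real.exp (α y) ≤ A1) (hB1 : ∫ y, ‖b y‖ * Real.exp (β y) ≤ B1)
    (hθ0 : 0 ≤ θ) (hθ1 : θ ≤ 1) :
    ‖∫ ζ in QN N, (ph τ ζ * Complex.exp ((θ : ℂ) * (lw ζ : ℂ))) *
      (IFT2 (fun y => a y * Complex.exp ((θ : ℂ) * (α y : ℂ))) ζ *
       FT2 (fun y => b y * Complex.exp ((θ : ℂ) * (β y : ℂ))) ζ)‖ ≤
      (√A0 * √B0) ^ (1 - θ) * (20 * (400 * |τ|⁻¹ * (A1 * B1))) ^ θ := by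
  have := phi_interp (Wst a b τ) (Lst α β) (Wst_meas a b ha2 hb2 τ N) (Lst_meas α β hα hβ)
    (WL_integrable a b α β hα hβ ha hb ha2 hb2 τ N) (√A0 * √B0) (400 * |τ|⁻¹ * (A1 * B1)) θ
    hθ0 hθ1 (Phi_bd0 a b α β hα hβ ha hb ha2 hb2 τ N A0 B0 hA0' hB0' hA0 hB0)
    (Phi_bd1 a b α β hα hβ ha hb ha2 hb2 τ N hτ hN A1 B1 hA1 hB1)
  rwa [Phi_eq1 a b α β hα hβ ha hb ha2 hb2 τ N θ (by simpa using hθ0) (by simpa using hθ1)] at this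

end stein


lemma exp_log_mul (f : ℝ) (hf : 0 ≤ f) (s t : ℝ) (hs : 0 < s) (hst : s + t ≠ 0) :
    f ^ s * Real.exp (t * Real.log f) = f ^ (s + t) := by
  rcases hf.eq_or_lt with h | h
  · rw [← h, Real.zero_rpow hs.ne', Real.zero_rpow hst, zero_mul]
  · rw [Real.rpow_def_of_pos h, Real.rpow_def_of_pos h, ← Real.exp_add]; congr 1; ring

lemma rpow_integrable (f : ℝ × ℝ → ℂ) (hf : Measurable f) (M R s : ℝ) (hM : ∀ y, ‖f y‖ ≤ M)
    (hR : ∀ y, y ∉ QN R → f y = 0) (hs : 0 < s) : Integrable (fun y => ‖f y‖ ^ s) := by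
  have h1 : IntegrableOn (fun y => ‖f y‖ ^ s) (QN R) := by
    have : IsFiniteMeasure (volume.restrict (QN R)) := ⟨by simpa using QN_fin R⟩
    refine Integrable.of_bound (C := M ^ s)
      (by fun_prop : Measurable fun y => ‖f y‖ ^ s).aestronglyMeasurable
      (Filter.Eventually.of_forall fun y => ?_)
    rw [Real.norm_of_nonneg (by positivity)]
    exact Real.rpow_le_rpow (norm_nonneg _) (hM y) hs.le
  rw [← integrableOn_univ]
  refine IntegrableOn.of_forall_diff_eq_zero h1 MeasurableSet.univ fun y hy => ?_
  rw [hR y hy.2, norm_zero, Real.zero_rpow hs.ne']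

lemma bilin_est (θ r : ℝ) (hθ0 : 0 ≤ θ) (hθ1 : θ ≤ 1) (hr : r = 2 / (1 + θ))
    (f h : ℝ × ℝ → ℂ) (hf : Measurable f) (hh : Measurable h) (M R : ℝ)
    (hfM : ∀ y, ‖f y‖ ≤ M) (hhM : ∀ y, ‖h y‖ ≤ M)
    (hfR : ∀ y, y ∉ QN R → f y = 0) (hhR : ∀ y, y ∉ QN R → h y = 0)
    (τ N : ℝ) (hτ : τ ≠ 0) (hN : 0 ≤ N) :
    ‖∫ ζ in QN N, (ph τ ζ * Complex.exp ((θ : ℂ) * (lw ζ : ℂ))) * (IFT2 f ζ * FT2 h ζ)‖ ≤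
      8000 ^ θ * (|τ| ^ (-θ) * (∫ y, ‖f y‖ ^ r) ^ ((1 + θ) / 2) *
        (∫ y, ‖h y‖ ^ r) ^ ((1 + θ) / 2)) := by
  have hr0 : 0 < r := by rw [hr]; positivity
  have hr1 : r / 2 * (1 + θ) = 1 := by rw [hr]; field_simp
  set am : (ℝ × ℝ → ℂ) → ℝ × ℝ → ℂ := fun f y =>
    f y * Complex.exp (((r / 2 - 1 : ℝ) : ℂ) * (Real.log ‖f y‖ : ℂ)) with ham
  set al : (ℝ × ℝ → ℂ) → ℝ × ℝ → ℝ := fun f y => r / 2 * Real.log ‖f y‖ with hal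
  have anorm : ∀ f : ℝ × ℝ → ℂ, ∀ y, ‖am f y‖ = ‖f y‖ ^ (r / 2) := by
    intro f y
    simp only [ham, norm_mul, Complex.norm_exp, Complex.re_mul_ofReal, Complex.ofReal_re]
    have := exp_log_mul ‖f y‖ (norm_nonneg _) 1 (r / 2 - 1) one_pos (by rw [add_sub_cancel]; positivity)
    rw [Real.rpow_one] at this
    rw [this]; congr 1; ring
  have anorm2 : ∀ f : ℝ × ℝ → ℂ, ∀ y, ‖am f y‖ * Real.exp (al f y) = ‖f y‖ ^ r := by
    intro f y
    rw [anorm, hal, exp_log_mul ‖f y‖ (norm_nonneg _) _ _ (by positivity) (by positivity)]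
    congr 1; ring
  have arec : ∀ f : ℝ × ℝ → ℂ, (fun y => am f y * Complex.exp ((θ : ℂ) * (al f y : ℂ))) = f := by
    intro f
    ext y
    simp only [ham, hal, mul_assoc, ← Complex.exp_add]
    have : ((r / 2 - 1 : ℝ) : ℂ) * (Real.log ‖f y‖ : ℂ) + (θ : ℂ) *
        ((r / 2 * Real.log ‖f y‖ : ℝ) : ℂ) = 0 := by
      have : (r / 2 - 1) * Real.log ‖f y‖ + θ * (r / 2 * Real.log ‖f y‖) = 0 := by
        linear_combination (Real.log ‖f y‖) * hr1
      exact_mod_cast this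
    rw [this]; simp
  have ameas : ∀ f : ℝ × ℝ → ℂ, Measurable f → Measurable (am f) := by
    intro f hf; simp only [ham]; fun_prop
  have almeas : ∀ f : ℝ × ℝ → ℂ, Measurable f → Measurable (al f) := by
    intro f hf; simp only [hal]; fun_prop
  have aint : ∀ f : ℝ × ℝ → ℂ, Measurable f → (∀ y, ‖f y‖ ≤ M) → (∀ y, y ∉ QN R → f y = 0) →
      Integrable (fun y => ‖am f y‖ * (1 + Real.exp (al f y))) := by
    intro f hf h1 h2
    simp only [mul_add, anorm2, mul_one]
    simp only [anorm]
    exact (rpow_integrable f hf M R _ h1 h2 (by positivity)).add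
      (rpow_integrable f hf M R _ h1 h2 hr0)
  have aL2 : ∀ f : ℝ × ℝ → ℂ, Measurable f → (∀ y, ‖f y‖ ≤ M) → (∀ y, y ∉ QN R → f y = 0) →
      ∫⁻ y, (‖am f y‖₊ : ℝ≥0∞) ^ (2:ℝ) = ENNReal.ofReal (∫ y, ‖f y‖ ^ r) := by
    intro f hf h1 h2
    rw [ofReal_integral_eq_lintegral_ofReal (rpow_integrable f hf M R _ h1 h2 hr0)
      (Filter.Eventually.of_forall fun y => by positivity)]
    congr 1
    ext y
    rw [← enorm_eq_nnnorm, ← ofReal_norm_eq_enorm, anorm,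
      ENNReal.ofReal_rpow_of_nonneg (by positivity) (by norm_num),
      ← Real.rpow_mul (norm_nonneg _)]
    congr 2; ring
  have amem : ∀ f : ℝ × ℝ → ℂ, Measurable f → (∀ y, ‖f y‖ ≤ M) → (∀ y, y ∉ QN R → f y = 0) →
      MemLp (am f) 2 := by
    intro f hf h1 h2
    refine ⟨(ameas f hf).aestronglyMeasurable, ?_⟩
    rw [eLpNorm_lt_top_iff_lintegral_rpow_enorm_lt_top (by norm_num) (by norm_num)]
    have := aL2 f hf h1 h2
    simp only [enorm_eq_nnnorm, ENNReal.toReal_ofNat]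
    rw [this]; exact ENNReal.ofReal_lt_top
  have Snn : ∀ f : ℝ × ℝ → ℂ, 0 ≤ ∫ y, ‖f y‖ ^ r := fun f =>
    integral_nonneg fun y => by positivity
  have := stein (am f) (am h) (al f) (al h) (almeas f hf) (almeas h hh) (aint f hf hfM hfR)
    (aint h hh hhM hhR) (amem f hf hfM hfR) (amem h hh hhM hhR) τ N (∫ y, ‖f y‖ ^ r)
    (∫ y, ‖h y‖ ^ r) (∫ y, ‖f y‖ ^ r) (∫ y, ‖h y‖ ^ r) θ hτ hN (Snn f) (Snn h)
    (aL2 f hf hfM hfR).le (aL2 h hh hhM hhR).le (by simp only [anorm2]; rfl)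
    (by simp only [anorm2]; rfl) hθ0 hθ1
  rw [arec, arec] at this
  refine this.trans (le_of_eq ?_)
  set A := ∫ y, ‖f y‖ ^ r with hA
  set B := ∫ y, ‖h y‖ ^ r with hB
  have hA0 : 0 ≤ A := Snn f
  have hB0 : 0 ≤ B := Snn h
  have hτ' := abs_pos.2 hτ
  have k : ∀ A : ℝ, 0 ≤ A → √A ^ (1 - θ) * A ^ θ = A ^ ((1 + θ) / 2) := by
    intro A hA
    rcases hA.eq_or_lt with h | h
    · rw [← h, Real.sqrt_zero, Real.zero_rpow (by positivity : (1 + θ) / 2 ≠ 0)]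
      rcases hθ0.eq_or_lt with h' | h'
      · rw [← h']; simp
      · rw [Real.zero_rpow h'.ne', mul_zero]
    · rw [Real.sqrt_eq_rpow, ← Real.rpow_mul hA, ← Real.rpow_add h]; congr 1; ring
  rw [show 20 * (400 * |τ|⁻¹ * (A * B)) = 8000 * (|τ|⁻¹ * (A * B)) by ring,
    Real.mul_rpow (by positivity) (by positivity), Real.mul_rpow (by norm_num) (by positivity),
    Real.mul_rpow (by positivity) (by positivity), Real.mul_rpow (by positivity) (by positivity),
    Real.inv_rpow hτ'.le, ← Real.rpow_neg hτ'.le, ← k A hA0, ← k B hB0]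
  ring


/-- space-time adjoint transform, time slice -/
def Hs (F : ℝ → ℝ × ℝ → ℂ) (t : ℝ) (ζ : ℝ × ℝ) : ℂ := ph t ζ * IFT2 (F t) ζ

/-- space-time adjoint transform -/
def Ft (F : ℝ → ℝ × ℝ → ℂ) (ζ : ℝ × ℝ) : ℂ := ∫ t, Hs F t ζ

lemma conj_ph (t : ℝ) (ζ : ℝ × ℝ) : (starRingEnd ℂ) (ph t ζ) = ph (-t) ζ := by
  unfold ph
  rw [← Complex.exp_conj, map_mul, Complex.conj_ofReal, Complex.conj_I]
  congr 1; push_cast; ring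

lemma ph_mul (t s : ℝ) (ζ : ℝ × ℝ) : ph t ζ * ph (-s) ζ = ph (t - s) ζ := by
  unfold ph
  rw [← Complex.exp_add]
  congr 1; push_cast; ring

lemma conj_IFT2 (f : ℝ × ℝ → ℂ) (ζ : ℝ × ℝ) :
    (starRingEnd ℂ) (IFT2 f ζ) = FT2 (fun y => (starRingEnd ℂ) (f y)) ζ := by
  unfold IFT2 FT2
  rw [← integral_conj]
  congr 1
  ext y
  rw [map_mul, ← Complex.exp_conj, map_mul, Complex.conj_ofReal, Complex.conj_I]
  congr 2; push_cast; ring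

section tt

lemma Hs_bd
    (F : ℝ → ℝ × ℝ → ℂ) (M R : ℝ) (hM : ∀ t y, ‖F t y‖ ≤ M)
    (hRt : ∀ t y, t ∉ Icc (-R) R → F t y = 0) (hRy : ∀ t y, y ∉ QN R → F t y = 0)
    (t : ℝ) (ζ : ℝ × ℝ) :
    ‖Hs F t ζ‖ ≤ (Icc (-R) R).indicator (fun _ => M * (volume (QN R)).toReal) t := by
  by_cases ht : t ∈ Icc (-R) R
  · rw [indicator_of_mem ht, Hs, norm_mul, ph_norm, one_mul, IFT2]
    rw [← setIntegral_eq_integral_of_forall_compl_eq_zero (s := QN R)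
      (fun y hy => by rw [hRy t y hy, mul_zero])]
    refine norm_setIntegral_le_of_norm_le_const (QN_fin R) (fun y _ => ?_)
    rw [norm_mul, Complex.norm_exp_ofReal_mul_I, one_mul]
    exact hM t y
  · rw [indicator_of_notMem ht, Hs, IFT2]
    simp [hRt t _ ht]

lemma Hs_meas
    (F : ℝ → ℝ × ℝ → ℂ) (hF : Measurable (Function.uncurry F)) : Measurable (Function.uncurry (Hs F)) := by
  have h : StronglyMeasurable (fun x : ℝ × (ℝ × ℝ) => IFT2 (F x.1) x.2) := by
    unfold IFT2
    have : StronglyMeasurable (fun x : (ℝ × (ℝ × ℝ)) × (ℝ × ℝ) =>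
      Complex.exp (((2 * Real.pi * (x.1.2.1 * x.2.1 + x.1.2.2 * x.2.2) : ℝ) : ℂ) * Complex.I) *
        F x.1.1 x.2) := by
      refine Measurable.stronglyMeasurable ?_
      have : Measurable (fun x : (ℝ × (ℝ × ℝ)) × (ℝ × ℝ) => F x.1.1 x.2) :=
        hF.comp (by fun_prop : Measurable fun x : (ℝ × (ℝ × ℝ)) × (ℝ × ℝ) => (x.1.1, x.2))
      fun_prop
    exact this.integral_prod_right
  have h2 : Measurable (fun x : ℝ × (ℝ × ℝ) => ph x.1 x.2) := by unfold ph; fun_prop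
  exact h2.mul h.measurable

lemma Hs_meas1
    (F : ℝ → ℝ × ℝ → ℂ) (hF : Measurable (Function.uncurry F)) : Measurable (fun x : (ℝ × ℝ) × (ℝ × ℝ) => Hs F x.2.1 x.1) :=
  Measurable.comp (g := Function.uncurry (Hs F))
    (f := fun x : (ℝ × ℝ) × (ℝ × ℝ) => ((x.2.1, x.1) : ℝ × (ℝ × ℝ))) (Hs_meas F hF) (by fun_prop)

lemma Hs_meas2
    (F : ℝ → ℝ × ℝ → ℂ) (hF : Measurable (Function.uncurry F)) : Measurable (fun x : (ℝ × ℝ) × (ℝ × ℝ) => Hs F x.2.2 x.1) :=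
  Measurable.comp (g := Function.uncurry (Hs F))
    (f := fun x : (ℝ × ℝ) × (ℝ × ℝ) => ((x.2.2, x.1) : ℝ × (ℝ × ℝ))) (Hs_meas F hF) (by fun_prop)

lemma bump_integrable (R K : ℝ) : Integrable ((Icc (-R) R).indicator (fun _ => K)) := by
  rw [integrable_indicator_iff measurableSet_Icc]
  exact integrableOn_const (by simp)

lemma Ft_meas
    (F : ℝ → ℝ × ℝ → ℂ) (hF : Measurable (Function.uncurry F)) : Measurable (Ft F) := by
  have : StronglyMeasurable (fun x : (ℝ × ℝ) × ℝ => Hs F x.2 x.1) :=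
    ((Hs_meas F hF).comp measurable_swap).stronglyMeasurable
  exact this.integral_prod_right.measurable

lemma Ft_bd
    (F : ℝ → ℝ × ℝ → ℂ) (M R : ℝ) (hM : ∀ t y, ‖F t y‖ ≤ M)
    (hRt : ∀ t y, t ∉ Icc (-R) R → F t y = 0) (hRy : ∀ t y, y ∉ QN R → F t y = 0)
    (ζ : ℝ × ℝ) : ‖Ft F ζ‖ ≤
    ∫ t, (Icc (-R) R).indicator (fun _ => M * (volume (QN R)).toReal) t :=
  norm_integral_le_of_norm_le (bump_integrable R _)
    (Filter.Eventually.of_forall fun t => Hs_bd F M R hM hRt hRy t ζ)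

lemma exp_theta_lw_le (θ : ℝ) (hθ0 : 0 ≤ θ) (hθ1 : θ ≤ 1) (ζ : ℝ × ℝ) :
    ‖Complex.exp ((θ : ℂ) * (lw ζ : ℂ))‖ ≤ 1 + Real.exp (lw ζ) := by
  rw [Complex.norm_exp, Complex.re_mul_ofReal, Complex.ofReal_re]
  exact exp_strip_bound _ _ hθ0 hθ1

lemma Ft_sq
    (F : ℝ → ℝ × ℝ → ℂ) (hF : Measurable (Function.uncurry F)) (M R : ℝ) (hM : ∀ t y, ‖F t y‖ ≤ M)
    (hRt : ∀ t y, t ∉ Icc (-R) R → F t y = 0) (hRy : ∀ t y, y ∉ QN R → F t y = 0)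
    (θ : ℝ) (hθ0 : 0 ≤ θ) (hθ1 : θ ≤ 1) (N : ℝ) :
    ∫ ζ in QN N, Complex.exp ((θ : ℂ) * (lw ζ : ℂ)) * (Ft F ζ * (starRingEnd ℂ) (Ft F ζ)) =
    ∫ x : ℝ × ℝ, ∫ ζ in QN N, (ph (x.1 - x.2) ζ * Complex.exp ((θ : ℂ) * (lw ζ : ℂ))) *
      (IFT2 (F x.1) ζ * FT2 (fun y => (starRingEnd ℂ) (F x.2 y)) ζ) := by
  have e : ∀ ζ, Complex.exp ((θ : ℂ) * (lw ζ : ℂ)) * (Ft F ζ * (starRingEnd ℂ) (Ft F ζ)) =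
      ∫ x : ℝ × ℝ, Complex.exp ((θ : ℂ) * (lw ζ : ℂ)) *
        (Hs F x.1 ζ * (starRingEnd ℂ) (Hs F x.2 ζ)) := by
    intro ζ
    rw [integral_const_mul, Measure.volume_eq_prod,
      integral_prod_mul (fun t => Hs F t ζ) (fun t => (starRingEnd ℂ) (Hs F t ζ)), Ft,
      ← integral_conj]
  simp only [e]
  rw [integral_integral_swap]
  · congr 1
    ext x
    congr 1
    ext ζ
    rw [Hs, Hs, map_mul, conj_ph, conj_IFT2, ← ph_mul]
    ring
  · have bi := bump_integrable R (M * (volume (QN R)).toReal)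
    refine ((lw_integrable N).mul_prod (bi.mul_prod bi)).mono' ?_ ?_
    · refine Measurable.aestronglyMeasurable ?_
      have h1 := Hs_meas1 F hF
      have h2 := Hs_meas2 F hF
      have h3 := lw_measurable
      have h4 : Measurable (fun x : (ℝ × ℝ) × (ℝ × ℝ) => (starRingEnd ℂ) (Hs F x.2.2 x.1)) :=
        Complex.continuous_conj.measurable.comp h2
      fun_prop
    · refine Filter.Eventually.of_forall fun x => ?_
      simp only [Function.uncurry, norm_mul, RCLike.norm_conj]
      have b1 := Hs_bd F M R hM hRt hRy x.2.1 x.1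
      have b2 := Hs_bd F M R hM hRt hRy x.2.2 x.1
      have b3 := exp_theta_lw_le θ hθ0 hθ1 x.1
      have := (norm_nonneg _).trans b1
      have := (norm_nonneg _).trans b2
      gcongr

end tt

lemma TTstar (p : ℝ) (hp : 2 < p) : ∃ C : ℝ≥0, 0 < C ∧ ∀ (F : ℝ → ℝ × ℝ → ℂ)
    (_ : Measurable (Function.uncurry F)) (M R : ℝ)
    (_ : ∀ t y, ‖F t y‖ ≤ M) (_ : ∀ t y, t ∉ Icc (-R) R → F t y = 0)
    (_ : ∀ t y, y ∉ QN R → F t y = 0) (N : ℝ) (_ : 0 ≤ N),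
    ∫⁻ ζ in QN N, ENNReal.ofReal (Real.exp (2 / p * lw ζ)) * (‖Ft F ζ‖₊ : ℝ≥0∞) ^ (2:ℝ) ≤
      C * (∫⁻ t, ENNReal.ofReal ((∫ y, ‖F t y‖ ^ (2 / (1 + 2 / p))) ^ ((1 + 2 / p) / 2)) ^
        (p / (p - 1))) ^ (2 / (p / (p - 1))) := by
  obtain ⟨C, hC, H⟩ := hls p _ hp rfl
  set θ := 2 / p with hθ
  have hθ0 : 0 < θ := by rw [hθ]; positivity
  have hθ1 : θ ≤ 1 := by rw [hθ, div_le_one (by linarith)]; linarith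
  refine ⟨Real.toNNReal (8000 ^ θ) * C, by positivity, ?_⟩
  intro F hF M R hM hRt hRy N hN
  set a : ℝ → ℝ := fun t => (∫ y, ‖F t y‖ ^ (2 / (1 + θ))) ^ ((1 + θ) / 2) with ha
  have ha0 : ∀ t, 0 ≤ a t := fun t => by positivity
  have ham : Measurable a := by
    have : StronglyMeasurable (fun x : ℝ × (ℝ × ℝ) => ‖F x.1 x.2‖ ^ (2 / (1 + θ))) := by
      refine Measurable.stronglyMeasurable ?_
      have : Measurable (fun x : ℝ × (ℝ × ℝ) => F x.1 x.2) := hF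
      fun_prop
    exact this.integral_prod_right.measurable.pow_const _
  have hmt : ∀ t, Measurable (F t) := fun t =>
    hF.comp (by fun_prop : Measurable fun y : ℝ × ℝ => (t, y))
  have hFtm := Ft_meas F hF
  -- step one
  have s1 : ∫⁻ ζ in QN N, ENNReal.ofReal (Real.exp (θ * lw ζ)) * (‖Ft F ζ‖₊ : ℝ≥0∞) ^ (2:ℝ) =
      ‖∫ ζ in QN N, Complex.exp ((θ : ℂ) * (lw ζ : ℂ)) *
        (Ft F ζ * (starRingEnd ℂ) (Ft F ζ))‖ₑ := by
    have e1 : ∀ ζ, Complex.exp ((θ : ℂ) * (lw ζ : ℂ)) * (Ft F ζ * (starRingEnd ℂ) (Ft F ζ)) =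
        ((Real.exp (θ * lw ζ) * ‖Ft F ζ‖ ^ 2 : ℝ) : ℂ) := by
      intro ζ
      rw [Complex.mul_conj, Complex.normSq_eq_norm_sq]
      push_cast; rfl
    simp only [e1]
    rw [integral_complex_ofReal, ← ofReal_norm_eq_enorm, Complex.norm_real, Real.norm_of_nonneg
      (integral_nonneg fun ζ => by positivity), ofReal_integral_eq_lintegral_ofReal]
    · congr 1
      ext ζ
      rw [ENNReal.ofReal_mul (Real.exp_pos _).le, ENNReal.ofReal_pow (norm_nonneg _),
        ofReal_norm_eq_enorm, enorm_eq_nnnorm]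
      norm_num
    · have lm := lw_measurable
      set K := ∫ t, (Icc (-R) R).indicator (fun _ => M * (volume (QN R)).toReal) t
      refine ((lw_integrable N).mul_const (K ^ 2)).mono'
        (by fun_prop : Measurable _).aestronglyMeasurable (Filter.Eventually.of_forall fun ζ => ?_)
      rw [Real.norm_of_nonneg (by positivity)]
      gcongr
      · exact exp_strip_bound _ _ hθ0.le hθ1
      · exact Ft_bd F M R hM hRt hRy ζ
    · exact Filter.Eventually.of_forall fun ζ => by positivity
  rw [s1, Ft_sq F hF M R hM hRt hRy θ hθ0.le hθ1 N]
  refine (enorm_integral_le_lintegral_enorm _).trans ?_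
  rw [Measure.volume_eq_prod]
  refine (lintegral_prod_le _).trans ?_
  calc _ ≤ ∫⁻ t, ∫⁻ s, ((Real.toNNReal (8000 ^ θ) : ℝ≥0) : ℝ≥0∞) *
        (ENNReal.ofReal (|t - s| ^ (-θ)) * ENNReal.ofReal (a s) * ENNReal.ofReal (a t)) := by
        refine lintegral_mono fun t => lintegral_mono_ae ?_
        have hne : ∀ᵐ s : ℝ, s ≠ t := by
          simp [ae_iff]
        filter_upwards [hne] with s hs
        have := bilin_est θ (2 / (1 + θ)) hθ0.le hθ1 rfl (F t) (fun y => (starRingEnd ℂ) (F s y))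
          (hmt t) (Complex.continuous_conj.measurable.comp (hmt s)) M R (hM t)
          (fun y => by rw [RCLike.norm_conj]; exact hM s y) (hRy t)
          (fun y hy => by simp [hRy s y hy]) (t - s) N (sub_ne_zero.2 hs.symm) hN
        simp only [RCLike.norm_conj] at this
        rw [← ofReal_norm_eq_enorm]
        refine (ENNReal.ofReal_le_ofReal this).trans (le_of_eq ?_)
        rw [ENNReal.ofReal_mul (by positivity), ENNReal.ofReal_mul (by positivity),
          ENNReal.ofReal_mul (by positivity)]
        simp only [ENNReal.ofReal, ha]
        ring
    _ = ((Real.toNNReal (8000 ^ θ) : ℝ≥0) : ℝ≥0∞) * ∫⁻ t, ∫⁻ s,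
        (ENNReal.ofReal (|t - s| ^ (-θ)) * ENNReal.ofReal (a s) * ENNReal.ofReal (a t)) := by
        rw [← lintegral_const_mul' _ _ ENNReal.coe_ne_top]
        congr 1
        ext t
        rw [← lintegral_const_mul' _ _ ENNReal.coe_ne_top]
    _ ≤ _ := by
        rw [ENNReal.coe_mul, mul_assoc]
        gcongr
        exact H a ham ha0


/-- truncated evolution -/
def uN (G : ℝ × ℝ → ℂ) (N : ℝ) (t : ℝ) (z : ℝ × ℝ) : ℂ :=
  ∫ ζ in QN N, ch z ζ * (ph t ζ * G ζ)

lemma ch_comm (z ζ : ℝ × ℝ) : ch z ζ = ch ζ z := by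
  unfold ch; congr 3; push_cast; ring

lemma uN_bd (G : ℝ × ℝ → ℂ) (N : ℝ) (t : ℝ) (z : ℝ × ℝ) :
    ‖uN G N t z‖ ≤ ∫ ζ in QN N, ‖G ζ‖ := by
  refine (norm_integral_le_integral_norm _).trans (le_of_eq ?_)
  congr 1
  ext ζ
  rw [norm_mul, norm_mul, ch_norm, ph_norm, one_mul, one_mul]

lemma uN_meas (G : ℝ × ℝ → ℂ) (hG : Measurable G) (N : ℝ) :
    Measurable (fun x : ℝ × (ℝ × ℝ) => uN G N x.1 x.2) := by
  have : StronglyMeasurable (fun x : (ℝ × (ℝ × ℝ)) × (ℝ × ℝ) =>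
      ch x.1.2 x.2 * (ph x.1.1 x.2 * G x.2)) := by
    refine Measurable.stronglyMeasurable ?_
    unfold ch ph
    fun_prop
  exact this.integral_prod_right.measurable

lemma pairing (F : ℝ → ℝ × ℝ → ℂ) (hF : Measurable (Function.uncurry F)) (M R : ℝ)
    (hM : ∀ t y, ‖F t y‖ ≤ M) (hRt : ∀ t y, t ∉ Icc (-R) R → F t y = 0)
    (hRy : ∀ t y, y ∉ QN R → F t y = 0) (G : ℝ × ℝ → ℂ) (hG : Measurable G) (N : ℝ)
    (hGi : IntegrableOn G (QN N)) :
    ∫ ζ in QN N, G ζ * Ft F ζ = ∫ x : ℝ × (ℝ × ℝ), F x.1 x.2 * uN G N x.1 x.2 := by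
  have hF' : Measurable (fun x : ℝ × (ℝ × ℝ) => F x.1 x.2) := hF
  have hFi : Integrable (fun x : ℝ × (ℝ × ℝ) => F x.1 x.2) := by
    rw [← integrableOn_univ]
    have h1 : IntegrableOn (fun x : ℝ × (ℝ × ℝ) => F x.1 x.2) (Icc (-R) R ×ˢ QN R) := by
      have : IsFiniteMeasure (volume.restrict (Icc (-R) R ×ˢ QN R)) := ⟨by
        rw [Measure.restrict_apply_univ, Measure.volume_eq_prod, Measure.prod_prod]
        exact ENNReal.mul_lt_top (by simp) (QN_fin R)⟩
      exact Integrable.of_bound (C := M) hF'.aestronglyMeasurable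
        (Filter.Eventually.of_forall fun x => hM _ _)
    refine IntegrableOn.of_forall_diff_eq_zero h1 MeasurableSet.univ fun x hx => ?_
    by_cases h : x.1 ∈ Icc (-R) R
    · exact hRy _ _ fun h' => hx.2 ⟨h, h'⟩
    · exact hRt _ _ h
  have hk : ∀ ζ : ℝ × ℝ, Integrable (fun x : ℝ × (ℝ × ℝ) => ph x.1 ζ * (ch ζ x.2 * F x.1 x.2)) := by
    intro ζ
    refine hFi.norm.mono' ?_ (Filter.Eventually.of_forall fun x => ?_)
    · refine Measurable.aestronglyMeasurable ?_
      unfold ph ch; fun_prop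
    · rw [norm_mul, norm_mul, ch_norm, ph_norm, one_mul, one_mul]
  have e : ∀ ζ, G ζ * Ft F ζ = ∫ x : ℝ × (ℝ × ℝ), G ζ * (ph x.1 ζ * (ch ζ x.2 * F x.1 x.2)) := by
    intro ζ
    rw [integral_const_mul, Measure.volume_eq_prod, integral_prod _ (hk ζ)]
    congr 1
    unfold Ft
    congr 1
    ext t
    rw [Hs, IFT2, ← integral_const_mul]
    rfl
  simp only [e]
  rw [integral_integral_swap]
  · congr 1
    ext x
    rw [uN, ← integral_const_mul]
    congr 1
    ext ζ
    rw [ch_comm]; ring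
  · refine (hGi.norm.mul_prod hFi.norm).mono' ?_ (Filter.Eventually.of_forall fun x => ?_)
    · refine Measurable.aestronglyMeasurable ?_
      have : Measurable (fun x : (ℝ × ℝ) × (ℝ × (ℝ × ℝ)) => F x.2.1 x.2.2) :=
        Measurable.comp (g := fun x : ℝ × (ℝ × ℝ) => F x.1 x.2) (f := Prod.snd) hF' measurable_snd
      unfold ph ch
      fun_prop
    · simp only [Function.uncurry, norm_mul, ch_norm, ph_norm, one_mul]
      exact le_rfl

lemma dual_alg (S X : ℝ≥0∞) (p : ℝ) (hp : 2 < p) (hS : S ≠ ⊤)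
    (h : S ≤ X * S ^ (1 / (p / (p - 1)))) : S ≤ X ^ p := by
  have hp0 : 0 < p := by linarith
  have hp1 : p - 1 ≠ 0 := by linarith
  rcases eq_or_ne S 0 with h0 | h0
  · rw [h0]; exact zero_le
  have e : S = S ^ (1 / p) * S ^ (1 / (p / (p - 1))) := by
    rw [← ENNReal.rpow_add _ _ h0 hS, show 1 / p + 1 / (p / (p - 1)) = 1 by field_simp; ring,
      ENNReal.rpow_one]
  have h1 : S ^ (1 / (p / (p - 1))) ≠ 0 := by
    simp [ENNReal.rpow_eq_zero_iff, h0, hS]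
  have h2 : S ^ (1 / (p / (p - 1))) ≠ ⊤ := by
    simp [ENNReal.rpow_eq_top_iff, h0, hS]
  have h3 : S ^ (1 / p) ≤ X := by
    rw [← ENNReal.mul_le_mul_iff_left h1 h2, ← e]
    exact h
  calc S = (S ^ (1 / p)) ^ p := by
        rw [← ENNReal.rpow_mul, one_div_mul_cancel hp0.ne', ENNReal.rpow_one]
    _ ≤ X ^ p := by gcongr


lemma rpow_between (a ε K s : ℝ) (hε : 0 < ε) (h1 : ε ≤ a) (h2 : a ≤ K) :
    a ^ s ≤ ε ^ s + K ^ s := by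
  have ha : 0 < a := hε.trans_le h1
  have hK : 0 < K := ha.trans_le h2
  rcases le_total 0 s with hs | hs
  · have := Real.rpow_le_rpow ha.le h2 hs
    have := Real.rpow_nonneg hε.le s
    linarith
  · have := Real.rpow_le_rpow_of_nonpos hε h1 hs
    have := Real.rpow_nonneg hK.le s
    linarith

/-- local space norm power -/
def TR (u : ℝ → ℝ × ℝ → ℂ) (q R t : ℝ) : ℝ := ∫ z in QN R, ‖u t z‖ ^ q

/-- good time set -/
def AR (u : ℝ → ℝ × ℝ → ℂ) (q R ε : ℝ) : Set ℝ := {t | t ∈ Icc (-R) R ∧ ε < TR u q R t}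

lemma TR_meas (u : ℝ → ℝ × ℝ → ℂ) (hu : Measurable (fun x : ℝ × (ℝ × ℝ) => u x.1 x.2))
    (q R : ℝ) : Measurable (TR u q R) := by
  have : StronglyMeasurable (fun x : ℝ × (ℝ × ℝ) => ‖u x.1 x.2‖ ^ q) :=
    (hu.norm.pow_const q).stronglyMeasurable
  exact this.integral_prod_right.measurable

lemma AR_meas (u : ℝ → ℝ × ℝ → ℂ) (hu : Measurable (fun x : ℝ × (ℝ × ℝ) => u x.1 x.2))
    (q R ε : ℝ) : MeasurableSet (AR u q R ε) :=
  measurableSet_Icc.inter (measurableSet_lt measurable_const (TR_meas u hu q R))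

lemma TR_le (u : ℝ → ℝ × ℝ → ℂ) (hu : Measurable (fun x : ℝ × (ℝ × ℝ) => u x.1 x.2)) (B : ℝ)
    (hB : ∀ t z, ‖u t z‖ ≤ B)
    (q R t : ℝ) (hq : 0 ≤ q) : TR u q R t ≤ B ^ q * (volume (QN R)).toReal := by
  have hB0 : 0 ≤ B := (norm_nonneg _).trans (hB 0 0)
  have : ‖∫ z in QN R, ‖u t z‖ ^ q‖ ≤ B ^ q * (volume (QN R)).toReal := by
    refine norm_setIntegral_le_of_norm_le_const (QN_fin R) fun z _ => ?_
    rw [Real.norm_of_nonneg (Real.rpow_nonneg (norm_nonneg _) _)]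
    exact Real.rpow_le_rpow (norm_nonneg _) (hB t z) hq
  exact (le_abs_self _).trans this

/-- extremizer weight -/
def cR (u : ℝ → ℝ × ℝ → ℂ) (p q R ε : ℝ) (t : ℝ) (z : ℝ × ℝ) : ℝ :=
  (AR u q R ε).indicator (fun t => TR u q R t ^ ((p - q) / q)) t *
    (QN R).indicator (fun z => ‖u t z‖ ^ (q - 2)) z

lemma cR_meas (u : ℝ → ℝ × ℝ → ℂ) (hu : Measurable (fun x : ℝ × (ℝ × ℝ) => u x.1 x.2))
    (p q R ε : ℝ) : Measurable (fun x : ℝ × (ℝ × ℝ) => cR u p q R ε x.1 x.2) := by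
  unfold cR
  refine Measurable.mul ?_ ?_
  · exact (((TR_meas u hu q R).pow_const _).indicator (AR_meas u hu q R ε)).comp measurable_fst
  · have : Measurable ((Prod.snd ⁻¹' (QN R)).indicator
        (fun x : ℝ × (ℝ × ℝ) => ‖u x.1 x.2‖ ^ (q - 2))) :=
      (hu.norm.pow_const _).indicator ((QN_meas R).preimage measurable_snd)
    convert this using 2 with x
    by_cases h : x.2 ∈ QN R
    · rw [indicator_of_mem h, indicator_of_mem (show x ∈ Prod.snd ⁻¹' QN R from h)]
    · rw [indicator_of_notMem h, indicator_of_notMem (show x ∉ Prod.snd ⁻¹' QN R from h)]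

lemma dual_F (p q : ℝ) (hp : 2 < p) (hq : 2 < q) (hpq : 2 / p + 2 / q = 1)
    (u : ℝ → ℝ × ℝ → ℂ) (hu : Measurable (fun x : ℝ × (ℝ × ℝ) => u x.1 x.2)) (B : ℝ)
    (hB : ∀ t z, ‖u t z‖ ≤ B) (R ε : ℝ) (hε : 0 < ε) :
    ∃ (F : ℝ → ℝ × ℝ → ℂ) (M : ℝ), Measurable (Function.uncurry F) ∧ (∀ t y, ‖F t y‖ ≤ M) ∧
      (∀ t y, t ∉ Icc (-R) R → F t y = 0) ∧ (∀ t y, y ∉ QN R → F t y = 0) ∧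
      (∫⁻ t, ENNReal.ofReal ((∫ y, ‖F t y‖^(2/(1+2/p)))^((1+2/p)/2))^(p/(p-1))) =
        (∫⁻ t, ENNReal.ofReal ((AR u q R ε).indicator (fun t => TR u q R t ^ (p / q)) t)) ∧
      ‖∫ x : ℝ × (ℝ × ℝ), F x.1 x.2 * u x.1 x.2‖ₑ =
        (∫⁻ t, ENNReal.ofReal ((AR u q R ε).indicator (fun t => TR u q R t ^ (p / q)) t)) ∧
      (∫⁻ t, ENNReal.ofReal ((AR u q R ε).indicator (fun t => TR u q R t ^ (p / q)) t)) ≠ ⊤ := by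
  have hB0 : 0 ≤ B := (norm_nonneg _).trans (hB 0 0)
  have hq0 : 0 < q := by linarith
  have hp0 : 0 < p := by linarith
  set K := B ^ q * (volume (QN R)).toReal with hK
  set s := (p - q) / q with hs
  have hTpos : ∀ t ∈ AR u q R ε, 0 < TR u q R t := fun t ht => hε.trans ht.2
  have hTn : ∀ t, 0 ≤ TR u q R t := fun t =>
    integral_nonneg fun z => Real.rpow_nonneg (norm_nonneg _) _
  have hK0 : 0 ≤ K := by positivity
  -- indicator bound
  have hib : ∀ t, (AR u q R ε).indicator (fun t => TR u q R t ^ s) t ≤ ε ^ s + K ^ s := by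
    intro t
    refine indicator_le' (g := fun _ => ε ^ s + K ^ s) (fun t ht => ?_)
      (fun t _ => by positivity) t
    exact rpow_between _ _ _ _ hε ht.2.le (TR_le u hu B hB q R t hq0.le)
  have hin : ∀ t, 0 ≤ (AR u q R ε).indicator (fun t => TR u q R t ^ s) t := fun t =>
    indicator_nonneg (fun t _ => Real.rpow_nonneg (hTn t) _) t
  have hcn : ∀ t z, 0 ≤ cR u p q R ε t z := fun t z =>
    mul_nonneg (hin t) (indicator_nonneg (fun z _ => by positivity) _)
  let F : ℝ → ℝ × ℝ → ℂ := fun t z => (cR u p q R ε t z : ℂ) * (starRingEnd ℂ) (u t z)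
  have hFn : ∀ t z, ‖F t z‖ = cR u p q R ε t z * ‖u t z‖ := by
    intro t z
    simp only [F, norm_mul, RCLike.norm_conj, Complex.norm_real, Real.norm_of_nonneg (hcn t z)]
  have hFn2 : ∀ t z, ‖F t z‖ = (AR u q R ε).indicator (fun t => TR u q R t ^ s) t *
      (QN R).indicator (fun z => ‖u t z‖ ^ (q - 1)) z := by
    intro t z
    rw [hFn, cR, mul_assoc]
    congr 1
    by_cases hz : z ∈ QN R
    · rw [indicator_of_mem hz, indicator_of_mem hz,
        show q - 1 = (q - 2) + 1 by ring, Real.rpow_add_one' (norm_nonneg _) (by linarith)]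
    · rw [indicator_of_notMem hz, indicator_of_notMem hz, zero_mul]
  have hFm : Measurable (Function.uncurry F) := by
    have h1 := cR_meas u hu p q R ε
    have h2 : Measurable (fun x : ℝ × (ℝ × ℝ) => (starRingEnd ℂ) (u x.1 x.2)) :=
      Complex.continuous_conj.measurable.comp hu
    exact (Complex.measurable_ofReal.comp h1).mul h2
  have hFM : ∀ t y, ‖F t y‖ ≤ (ε ^ s + K ^ s) * B ^ (q - 1) := by
    intro t y
    rw [hFn2]
    refine mul_le_mul (hib t) ?_ (indicator_nonneg (fun z _ => by positivity) _) (by positivity)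
    refine indicator_le' (g := fun _ => B ^ (q - 1)) (fun z _ => ?_)
      (fun z _ => by positivity) y
    exact Real.rpow_le_rpow (norm_nonneg _) (hB t z) (by linarith)
  have hFt : ∀ t y, t ∉ Icc (-R) R → F t y = 0 := by
    intro t y ht
    rw [← norm_eq_zero, hFn2, indicator_of_notMem (fun h => ht h.1), zero_mul]
  have hFy : ∀ t y, y ∉ QN R → F t y = 0 := by
    intro t y hy
    rw [← norm_eq_zero, hFn2, indicator_of_notMem hy, mul_zero]
  -- space norm
  have hr' : (1 + 2 / p) / 2 = (q - 1) / q := by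
    have : 2 / p = 1 - 2 / q := by linarith
    rw [this]; field_simp; ring
  have hr : 2 / (1 + 2 / p) = q / (q - 1) := by
    rw [← inv_div, hr', inv_div]
  have hq1 : q - 1 ≠ 0 := by linarith
  have hp1 : p - 1 ≠ 0 := by linarith
  have hsp : ∀ t, (∫ y, ‖F t y‖^(2/(1+2/p))) =
      ((AR u q R ε).indicator (fun t => TR u q R t ^ s) t) ^ (q / (q - 1)) * TR u q R t := by
    intro t
    rw [hr, TR, ← integral_indicator (QN_meas R), ← integral_const_mul]
    congr 1
    ext z
    rw [hFn2, Real.mul_rpow (hin t) (indicator_nonneg (fun z _ => by positivity) _)]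
    congr 1
    by_cases hz : z ∈ QN R
    · rw [indicator_of_mem hz, indicator_of_mem hz, ← Real.rpow_mul (norm_nonneg _)]
      congr 1; field_simp
    · rw [indicator_of_notMem hz, indicator_of_notMem hz, Real.zero_rpow]
      exact (div_pos hq0 (by linarith)).ne'
  have hi : ∀ t, ENNReal.ofReal ((∫ y, ‖F t y‖^(2/(1+2/p)))^((1+2/p)/2))^(p/(p-1)) =
      ENNReal.ofReal ((AR u q R ε).indicator (fun t => TR u q R t ^ (p / q)) t) := by
    intro t
    rw [hsp, hr', ENNReal.ofReal_rpow_of_nonneg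
      (Real.rpow_nonneg (mul_nonneg (Real.rpow_nonneg (hin t) _) (hTn t)) _)
      (div_nonneg hp0.le (by linarith))]
    congr 1
    by_cases ht : t ∈ AR u q R ε
    · have hT := hTpos t ht
      rw [indicator_of_mem ht, indicator_of_mem ht]
      nth_rw 2 [← Real.rpow_one (TR u q R t)]
      rw [← Real.rpow_mul hT.le, ← Real.rpow_add hT, ← Real.rpow_mul hT.le, ← Real.rpow_mul hT.le]
      congr 1
      rw [hs]; field_simp; ring
    · rw [indicator_of_notMem ht, indicator_of_notMem ht, Real.zero_rpow, zero_mul, Real.zero_rpow,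
        Real.zero_rpow]
      · have : 0 < p - 1 := by linarith
        positivity
      · have : 0 < q - 1 := by linarith
        positivity
      · have : 0 < q - 1 := by linarith
        positivity
  -- pairing
  have hFu : ∀ t z, F t z * u t z =
      (((AR u q R ε).indicator (fun t => TR u q R t ^ s) t *
      (QN R).indicator (fun z => ‖u t z‖ ^ q) z : ℝ) : ℂ) := by
    intro t z
    simp only [F]
    rw [mul_assoc, mul_comm ((starRingEnd ℂ) (u t z)), Complex.mul_conj, ← Complex.ofReal_mul,
      Complex.normSq_eq_norm_sq, cR, mul_assoc]
    congr 2
    by_cases hz : z ∈ QN R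
    · rw [indicator_of_mem hz, indicator_of_mem hz, ← Real.rpow_two,
        ← Real.rpow_add' (norm_nonneg _) (by linarith)]
      congr 1; ring
    · rw [indicator_of_notMem hz, indicator_of_notMem hz, zero_mul]
  have hin' : ∀ t, 0 ≤ (AR u q R ε).indicator (fun t => TR u q R t ^ (p / q)) t := fun t =>
    indicator_nonneg (fun t _ => Real.rpow_nonneg (hTn t) _) t
  have hint1 : Integrable (fun t => (AR u q R ε).indicator (fun t => TR u q R t ^ (p / q)) t) := by
    rw [integrable_indicator_iff (AR_meas u hu q R ε)]
    have : IntegrableOn (fun t => TR u q R t ^ (p / q)) (Icc (-R) R) := by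
      refine Integrable.of_bound (C := K ^ (p / q))
        ((TR_meas u hu q R).pow_const _).aestronglyMeasurable
        (Filter.Eventually.of_forall fun t => ?_)
      rw [Real.norm_of_nonneg (Real.rpow_nonneg (hTn t) _)]
      exact Real.rpow_le_rpow (hTn t) (TR_le u hu B hB q R t hq0.le) (by positivity)
    exact this.mono_set fun t ht => ht.1
  have hint2 : Integrable (fun x : ℝ × (ℝ × ℝ) =>
      ((AR u q R ε).indicator (fun t => TR u q R t ^ s) x.1 *
      (QN R).indicator (fun z => ‖u x.1 z‖ ^ q) x.2 : ℝ)) := by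
    have hm : Measurable (fun x : ℝ × (ℝ × ℝ) => F x.1 x.2 * u x.1 x.2) := hFm.mul hu
    have h1 : IntegrableOn (fun x : ℝ × (ℝ × ℝ) => F x.1 x.2 * u x.1 x.2)
        (Icc (-R) R ×ˢ QN R) := by
      have : IsFiniteMeasure (volume.restrict (Icc (-R) R ×ˢ QN R)) := ⟨by
        rw [Measure.restrict_apply_univ, Measure.volume_eq_prod, Measure.prod_prod]
        exact ENNReal.mul_lt_top (by simp) (QN_fin R)⟩
      refine Integrable.of_bound (C := (ε ^ s + K ^ s) * B ^ (q - 1) * B) hm.aestronglyMeasurable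
        (Filter.Eventually.of_forall fun x => ?_)
      rw [norm_mul]
      exact mul_le_mul (hFM _ _) (hB _ _) (norm_nonneg _) (by positivity)
    have h2 : Integrable (fun x : ℝ × (ℝ × ℝ) => F x.1 x.2 * u x.1 x.2) := by
      rw [← integrableOn_univ]
      refine IntegrableOn.of_forall_sdiff_eq_zero h1 MeasurableSet.univ fun x hx => ?_
      by_cases h : x.1 ∈ Icc (-R) R
      · rw [hFy _ _ fun h' => hx.2 ⟨h, h'⟩, zero_mul]
      · rw [hFt _ _ h, zero_mul]
    simp only [hFu] at h2
    exact h2.re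
  refine ⟨F, _, hFm, hFM, hFt, hFy, by simp only [hi], ?_, ?_⟩
  · simp only [hFu]
    rw [integral_complex_ofReal, Measure.volume_eq_prod, integral_prod _ hint2,
      ← ofReal_integral_eq_lintegral_ofReal hint1 (Filter.Eventually.of_forall hin')]
    have : ∀ t, ∫ z, (AR u q R ε).indicator (fun t => TR u q R t ^ s) t *
        (QN R).indicator (fun z => ‖u t z‖ ^ q) z =
        (AR u q R ε).indicator (fun t => TR u q R t ^ (p / q)) t := by
      intro t
      rw [integral_const_mul, integral_indicator (QN_meas R)]
      by_cases ht : t ∈ AR u q R ε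
      · have hT := hTpos t ht
        rw [indicator_of_mem ht, indicator_of_mem ht]
        change TR u q R t ^ s * TR u q R t = _
        rw [← Real.rpow_add_one hT.ne']
        congr 1
        rw [hs]; field_simp; ring
      · rw [indicator_of_notMem ht, indicator_of_notMem ht, zero_mul]
    simp only [this]
    rw [← ofReal_norm, Complex.norm_real, Real.norm_of_nonneg (integral_nonneg hin')]
  · rw [← ofReal_integral_eq_lintegral_ofReal hint1 (Filter.Eventually.of_forall hin')]
    exact ENNReal.ofReal_ne_top


/-- weighted data -/
def Gw (p : ℝ) (g : ℝ × ℝ → ℂ) (ζ : ℝ × ℝ) : ℂ := ((Real.exp (1 / p * lw ζ) : ℝ) : ℂ) * g ζ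

lemma Gw_meas (p : ℝ) (g : ℝ × ℝ → ℂ) (hg : Measurable g) : Measurable (Gw p g) := by
  have := lw_measurable
  unfold Gw
  fun_prop

lemma Gw_int (p : ℝ) (hp : 2 < p) (g : ℝ × ℝ → ℂ) (hg : Continuous g) (N : ℝ) :
    IntegrableOn (Gw p g) (QN N) := by
  have hc : IsCompact (QN N) := isCompact_Icc.prod isCompact_Icc
  obtain ⟨D, hD⟩ := hc.exists_bound_of_continuousOn hg.continuousOn
  refine ((lw_integrable N).mul_const D).mono' (Gw_meas p g hg.measurable).aestronglyMeasurable ?_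
  rw [ae_restrict_iff' (QN_meas N)]
  refine Filter.Eventually.of_forall fun ζ hζ => ?_
  rw [Gw, norm_mul, Complex.norm_real, Real.norm_of_nonneg (Real.exp_pos _).le]
  have h1 := exp_strip_bound (1 / p) (lw ζ) (by positivity)
    (by rw [div_le_one (by linarith)]; linarith)
  exact mul_le_mul h1 (hD ζ hζ) (norm_nonneg _) (by positivity)

lemma local_est (p q : ℝ) (hp : 2 < p) (hq : 2 < q) (hpq : 2 / p + 2 / q = 1) :
    ∃ C : ℝ≥0, 0 < C ∧ ∀ (g : ℝ × ℝ → ℂ) (_ : Continuous g) (N R ε : ℝ) (_ : 0 ≤ N) (_ : 0 < ε),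
      (∫⁻ t, ENNReal.ofReal ((AR (uN (Gw p g) N) q R ε).indicator
        (fun t => TR (uN (Gw p g) N) q R t ^ (p / q)) t)) ≤
        ((C : ℝ≥0∞) * (∫⁻ ζ, (‖g ζ‖₊ : ℝ≥0∞) ^ (2 : ℝ)) ^ (1 / 2 : ℝ)) ^ p := by
  obtain ⟨C, hC, hT⟩ := TTstar p hp
  refine ⟨C ^ (1 / 2 : ℝ), NNReal.rpow_pos hC, fun g hg N R ε hN hε => ?_⟩
  have hGm := Gw_meas p g hg.measurable
  have hGi := Gw_int p hp g hg N
  obtain ⟨F, M, hF, hM, hRt, hRy, e1, e2, e3⟩ := dual_F p q hp hq hpq (uN (Gw p g) N)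
    (uN_meas _ hGm N) _ (uN_bd (Gw p g) N) R ε hε
  have h1 := hT F hF M R hM hRt hRy N hN
  rw [e1] at h1
  rw [← pairing F hF M R hM hRt hRy _ hGm N hGi] at e2
  set S := (∫⁻ t, ENNReal.ofReal ((AR (uN (Gw p g) N) q R ε).indicator
        (fun t => TR (uN (Gw p g) N) q R t ^ (p / q)) t)) with hS
  refine dual_alg S _ p hp e3 ?_
  have hFtm : Measurable (Ft F) := Ft_meas F hF
  have hlw := lw_measurable
  have hgm := hg.measurable
  calc S = ‖∫ ζ in QN N, Gw p g ζ * Ft F ζ‖ₑ := e2.symm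
    _ ≤ ∫⁻ ζ in QN N, ‖Gw p g ζ * Ft F ζ‖ₑ := enorm_integral_le_lintegral_enorm _
    _ = ∫⁻ ζ in QN N, ((fun ζ => (‖g ζ‖₊ : ℝ≥0∞)) *
        (fun ζ => ENNReal.ofReal (Real.exp (1 / p * lw ζ)) * (‖Ft F ζ‖₊ : ℝ≥0∞))) ζ := by
        refine lintegral_congr fun ζ => ?_
        rw [Gw, enorm_mul, enorm_mul, ← ofReal_norm ((Real.exp (1 / p * lw ζ) : ℝ) : ℂ),
          Complex.norm_real, Real.norm_of_nonneg (Real.exp_pos _).le, Pi.mul_apply]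
        simp only [enorm]
        ring
    _ ≤ (∫⁻ ζ in QN N, (‖g ζ‖₊ : ℝ≥0∞) ^ (2 : ℝ)) ^ (1 / (2 : ℝ)) *
        (∫⁻ ζ in QN N, (ENNReal.ofReal (Real.exp (1 / p * lw ζ)) * (‖Ft F ζ‖₊ : ℝ≥0∞)) ^ (2 : ℝ)) ^
          (1 / (2 : ℝ)) := by
        refine ENNReal.lintegral_mul_le_Lp_mul_Lq _ Real.HolderConjugate.two_two ?_ ?_
        · exact Measurable.aemeasurable (by fun_prop)
        · exact Measurable.aemeasurable (by fun_prop)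
    _ ≤ (∫⁻ ζ, (‖g ζ‖₊ : ℝ≥0∞) ^ (2 : ℝ)) ^ (1 / (2 : ℝ)) *
        (C * S ^ (2 / (p / (p - 1)))) ^ (1 / (2 : ℝ)) := by
        gcongr
        · exact Measure.restrict_le_self
        · refine le_trans (le_of_eq ?_) h1
          refine lintegral_congr fun ζ => ?_
          rw [ENNReal.mul_rpow_of_nonneg _ _ (by norm_num),
            ENNReal.ofReal_rpow_of_pos (Real.exp_pos _), ← Real.exp_mul]
          congr 3
          ring
    _ = _ := by
        rw [ENNReal.mul_rpow_of_nonneg _ _ (by norm_num), ← ENNReal.rpow_mul,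
          ← ENNReal.coe_rpow_of_nonneg _ (by norm_num : (0 : ℝ) ≤ 1 / 2),
          show 2 / (p / (p - 1)) * (1 / 2) = 1 / (p / (p - 1)) by ring]
        ring


lemma QN_eventually (z : ℝ × ℝ) : ∀ᶠ n : ℕ in Filter.atTop, z ∈ QN (n : ℝ) := by
  obtain ⟨m, hm⟩ := exists_nat_ge (max |z.1| |z.2|)
  filter_upwards [Filter.eventually_ge_atTop m] with n hn
  have hn' : (m : ℝ) ≤ n := by exact_mod_cast hn
  have h1 := abs_le.1 (((le_max_left _ _).trans hm).trans hn')
  have h2 := abs_le.1 (((le_max_right _ _).trans hm).trans hn')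
  exact ⟨h1, h2⟩

lemma uN_tendsto (G : ℝ × ℝ → ℂ) (hG : Measurable G) (hGi : Integrable G) (t : ℝ) (z : ℝ × ℝ) :
    Filter.Tendsto (fun n : ℕ => uN G n t z) Filter.atTop
      (nhds (∫ ζ, ch z ζ * (ph t ζ * G ζ))) := by
  have hm : Measurable (fun ζ => ch z ζ * (ph t ζ * G ζ)) := by
    unfold ch ph; fun_prop
  have e : ∀ n : ℕ, uN G n t z = ∫ ζ, (QN n).indicator (fun ζ => ch z ζ * (ph t ζ * G ζ)) ζ :=
    fun n => (integral_indicator (QN_meas n)).symm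
  simp only [e]
  refine tendsto_integral_of_dominated_convergence (fun ζ => ‖G ζ‖)
    (fun n => (hm.indicator (QN_meas n)).aestronglyMeasurable) hGi.norm
    (fun n => Filter.Eventually.of_forall fun ζ => ?_)
    (Filter.Eventually.of_forall fun ζ => ?_)
  · refine (norm_indicator_le_norm_self _ _).trans (le_of_eq ?_)
    rw [norm_mul, norm_mul, ch_norm, ph_norm, one_mul, one_mul]
  · refine tendsto_const_nhds.congr' ?_
    filter_upwards [QN_eventually ζ] with n hn
    rw [indicator_of_mem hn]

lemma sec_meas (u : ℝ → ℝ × ℝ → ℂ) (hu : Measurable (fun x : ℝ × (ℝ × ℝ) => u x.1 x.2))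
    (t : ℝ) : Measurable (u t) := hu.comp measurable_prodMk_left

lemma ofReal_TR (u : ℝ → ℝ × ℝ → ℂ) (hu : Measurable (fun x : ℝ × (ℝ × ℝ) => u x.1 x.2)) (B : ℝ)
    (hB : ∀ t z, ‖u t z‖ ≤ B) (q R t : ℝ) (hq : 0 < q) :
    ENNReal.ofReal (TR u q R t) =
      ∫⁻ z, (QN R).indicator (fun z => (‖u t z‖₊ : ℝ≥0∞) ^ q) z := by
  have hm : Measurable (u t) := hu.comp measurable_prodMk_left
  rw [lintegral_indicator (QN_meas R), TR, ofReal_integral_eq_lintegral_ofReal]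
  · refine lintegral_congr fun z => ?_
    rw [← ENNReal.ofReal_rpow_of_nonneg (norm_nonneg _) hq.le, ofReal_norm]
    rfl
  · have : IsFiniteMeasure (volume.restrict (QN R)) := ⟨by
      rw [Measure.restrict_apply_univ]; exact QN_fin R⟩
    refine Integrable.of_bound (C := B ^ q) (hm.norm.pow_const q).aestronglyMeasurable
      (Filter.Eventually.of_forall fun z => ?_)
    rw [Real.norm_of_nonneg (Real.rpow_nonneg (norm_nonneg _) _)]
    exact Real.rpow_le_rpow (norm_nonneg _) (hB t z) hq.le
  · exact Filter.Eventually.of_forall fun z => Real.rpow_nonneg (norm_nonneg _) _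

set_option maxHeartbeats 1000000 in
lemma global_est (p q : ℝ) (hp : 2 < p) (hq : 2 < q) (hpq : 2 / p + 2 / q = 1) :
    ∃ C : ℝ≥0, 0 < C ∧ ∀ (g : ℝ × ℝ → ℂ) (_ : Continuous g) (_ : Integrable (Gw p g)),
      (∫⁻ t, (∫⁻ z, (‖∫ ζ, ch z ζ * (ph t ζ * Gw p g ζ)‖₊ : ℝ≥0∞) ^ q) ^ (p / q)) ≤
        ((C : ℝ≥0∞) * (∫⁻ ζ, (‖g ζ‖₊ : ℝ≥0∞) ^ (2 : ℝ)) ^ (1 / 2 : ℝ)) ^ p := by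
  obtain ⟨C, hC, hL⟩ := local_est p q hp hq hpq
  refine ⟨C, hC, fun g hg hGi => ?_⟩
  have hp0 : 0 < p := by linarith
  have hq0 : 0 < q := by linarith
  have hpq0 : 0 < p / q := by positivity
  have hGm := Gw_meas p g hg.measurable
  set v : ℕ → ℝ → ℝ × ℝ → ℂ := fun n => uN (Gw p g) n with hv
  have hvm : ∀ n, Measurable (fun x : ℝ × (ℝ × ℝ) => v n x.1 x.2) := fun n => uN_meas _ hGm n
  set f : ℕ → ℝ → ℝ≥0∞ := fun n t =>
    ENNReal.ofReal ((AR (v n) q n (1 / ((n : ℝ) + 1))).indicator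
        (fun t => TR (v n) q n t ^ (p / q)) t) with hf
  have hfm : ∀ n, Measurable (f n) := fun n =>
    (((TR_meas _ (hvm n) q n).pow_const _).indicator (AR_meas _ (hvm n) q n _)).ennreal_ofReal
  have hfb : ∀ n, ∫⁻ t, f n t ≤
      ((C : ℝ≥0∞) * (∫⁻ ζ, (‖g ζ‖₊ : ℝ≥0∞) ^ (2 : ℝ)) ^ (1 / 2 : ℝ)) ^ p := fun n =>
    hL g hg n n _ (by positivity) (by positivity)
  have key : ∀ t, (∫⁻ z, (‖∫ ζ, ch z ζ * (ph t ζ * Gw p g ζ)‖₊ : ℝ≥0∞) ^ q) ^ (p / q) ≤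
      Filter.liminf (fun n => f n t) Filter.atTop := by
    intro t
    set T := ∫⁻ z, (‖∫ ζ, ch z ζ * (ph t ζ * Gw p g ζ)‖₊ : ℝ≥0∞) ^ q with hT
    have hTl : T ≤ Filter.liminf (fun n : ℕ => ENNReal.ofReal (TR (v n) q n t)) Filter.atTop := by
      have e : ∀ n : ℕ, ENNReal.ofReal (TR (v n) q n t) =
          ∫⁻ z, (QN n).indicator (fun z => (‖v n t z‖₊ : ℝ≥0∞) ^ q) z := fun n =>
        ofReal_TR _ (hvm n) _ (uN_bd (Gw p g) n) q n t hq0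
      simp only [e]
      refine le_trans (le_of_eq ?_) (lintegral_liminf_le fun n => ?_)
      · refine lintegral_congr fun z => ?_
        refine (Filter.Tendsto.liminf_eq ?_).symm
        have h1 : Filter.Tendsto (fun n => (‖v n t z‖₊ : ℝ≥0∞) ^ q) Filter.atTop
            (nhds ((‖∫ ζ, ch z ζ * (ph t ζ * Gw p g ζ)‖₊ : ℝ≥0∞) ^ q)) :=
          (ENNReal.continuous_rpow_const.tendsto _).comp
            (ENNReal.tendsto_coe.2 (uN_tendsto _ hGm hGi t z).nnnorm)
        refine h1.congr' ?_
        filter_upwards [QN_eventually z] with n hn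
        rw [indicator_of_mem hn]
      · have hm : Measurable (v n t) := sec_meas _ (hvm n) t
        exact (hm.nnnorm.coe_nnreal_ennreal.pow_const q).indicator (QN_meas n)
    rcases eq_or_ne T 0 with h0 | h0
    · rw [h0, ENNReal.zero_rpow_of_pos hpq0]; exact zero_le
    refine le_of_forall_lt fun c hc => ?_
    obtain ⟨c', hc1, hc2⟩ := exists_between hc
    refine hc1.trans_le ?_
    have hd : c' ^ (q / p) < T := by
      have := ENNReal.rpow_lt_rpow hc2 (show 0 < q / p by positivity)
      rwa [← ENNReal.rpow_mul, show p / q * (q / p) = 1 by field_simp, ENNReal.rpow_one] at this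
    obtain ⟨e, he0, he⟩ := exists_between (pos_iff_ne_zero.2 h0)
    have htt : Filter.Tendsto (fun n : ℕ => ENNReal.ofReal (1 / ((n : ℝ) + 1))) Filter.atTop
        (nhds 0) := by
      rw [← ENNReal.ofReal_zero]
      exact ENNReal.tendsto_ofReal tendsto_one_div_add_atTop_nhds_zero_nat
    refine Filter.le_liminf_of_le (by isBoundedDefault) ?_
    filter_upwards [Filter.eventually_lt_of_lt_liminf (hd.trans_le hTl),
      Filter.eventually_lt_of_lt_liminf (he.trans_le hTl), htt.eventually_lt_const he0,
      QN_eventually (t, 0)] with n h1 h2 h3 h4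
    have hA : t ∈ AR (v n) q n (1 / ((n : ℝ) + 1)) := by
      refine ⟨h4.1, ?_⟩
      exact (ENNReal.ofReal_lt_ofReal_iff_of_nonneg (by positivity)).1 (h3.trans h2)
    rw [hf]
    simp only
    rw [indicator_of_mem hA, ← ENNReal.ofReal_rpow_of_nonneg
      (show 0 ≤ TR (v n) q n t from integral_nonneg fun z => Real.rpow_nonneg (norm_nonneg _) _) hpq0.le]
    calc c' = (c' ^ (q / p)) ^ (p / q) := by
          rw [← ENNReal.rpow_mul, show q / p * (p / q) = 1 by field_simp, ENNReal.rpow_one]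
      _ ≤ _ := by gcongr
  calc _ ≤ ∫⁻ t, Filter.liminf (fun n => f n t) Filter.atTop := lintegral_mono key
    _ ≤ Filter.liminf (fun n => ∫⁻ t, f n t) Filter.atTop := lintegral_liminf_le hfm
    _ ≤ _ := Filter.liminf_le_of_le (by isBoundedDefault) fun b hb => by
      obtain ⟨n, hn⟩ := hb.exists
      exact hn.trans (hfb n)


lemma char_norm (a : ℝ) : ‖Complex.exp ((a : ℂ) * Complex.I)‖ = 1 :=
  Complex.norm_exp_ofReal_mul_I a

lemma unimod_int (f : ℝ × ℝ → ℂ) (w : ℝ × ℝ → ℝ) (hw : Measurable w)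
    (h : Integrable (fun q => Complex.exp ((w q : ℂ) * Complex.I) * f q)) : Integrable f := by
  have h1 : Integrable (fun q => Complex.exp (((-w q : ℝ) : ℂ) * Complex.I) *
      (Complex.exp ((w q : ℂ) * Complex.I) * f q)) := by
    refine h.bdd_mul (c := 1) (Measurable.aestronglyMeasurable (by fun_prop))
      (Filter.Eventually.of_forall fun q => (char_norm _).le)
  refine h1.congr (Filter.Eventually.of_forall fun q => ?_)
  simp only
  rw [← mul_assoc, ← Complex.exp_add]
  push_cast
  rw [show -(w q : ℂ) * Complex.I + w q * Complex.I = 0 by ring, Complex.exp_zero, one_mul]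

lemma FT2_undef (f : ℝ × ℝ → ℂ) (h : ¬ Integrable f) (p : ℝ × ℝ) : FT2 f p = 0 :=
  integral_undef fun h' => h (unimod_int f _ (by fun_prop) h')

lemma IFT2_undef (f : ℝ × ℝ → ℂ) (h : ¬ Integrable f) (p : ℝ × ℝ) : IFT2 f p = 0 :=
  integral_undef fun h' => h (unimod_int f _ (by fun_prop) h')

lemma FT2_zero (f : ℝ × ℝ → ℂ) (h : ∀ q, f q = 0) (p : ℝ × ℝ) : FT2 f p = 0 := by
  simp [FT2, h]

lemma IFT2_zero (f : ℝ × ℝ → ℂ) (h : ∀ q, f q = 0) (p : ℝ × ℝ) : IFT2 f p = 0 := by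
  simp [IFT2, h]

lemma FT2_Ugrp (t : ℝ) (φ : ℝ × ℝ → ℂ) :
    (∀ ζ, FT2 (Ugrp t φ) ζ = 0) ∨
      (Integrable φ ∧ ∀ ζ, FT2 (Ugrp t φ) ζ = ph t ζ * FT2 φ ζ) := by
  by_cases hφ : Integrable φ
  swap
  · left
    refine FT2_zero _ fun z => IFT2_zero _ (fun q => ?_) z
    rw [FT2_undef φ hφ, mul_zero]
  by_cases hi : Integrable (fun ζ => ph t ζ * FT2 φ ζ)
  swap
  · left
    exact FT2_zero _ fun z => IFT2_undef _ hi z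
  by_cases hU : Integrable (IFT2 (fun ζ => ph t ζ * FT2 φ ζ))
  swap
  · left
    exact FT2_undef _ hU
  right
  refine ⟨hφ, fun ζ => ?_⟩
  have hc : Continuous (fun ζ => ph t ζ * FT2 φ ζ) := by
    have := FT2_continuous φ hφ
    unfold ph
    fun_prop
  exact congrFun (FT2_IFT2 _ hc hi hU) ζ

lemma symb_ae (p : ℝ) : ∀ᵐ ζ : ℝ × ℝ,
    (|ζ.1| ^ (1 / (2 * p)) * |ζ.2| ^ (1 / (2 * p)) : ℝ) = Real.exp (1 / p * lw ζ) := by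
  have h0 : ∀ᵐ x : ℝ, x ≠ 0 := by
    rw [ae_iff]; simp
  have h1 : ∀ᵐ ζ : ℝ × ℝ, ζ.1 ≠ 0 := Measure.quasiMeasurePreserving_fst.ae h0
  have h2 : ∀ᵐ ζ : ℝ × ℝ, ζ.2 ≠ 0 := Measure.quasiMeasurePreserving_snd.ae h0
  filter_upwards [h1, h2] with ζ h1 h2
  rw [Real.rpow_def_of_pos (abs_pos.2 h1), Real.rpow_def_of_pos (abs_pos.2 h2), ← Real.exp_add,
    Real.log_abs, Real.log_abs, lw]
  congr 1
  by_cases hp : p = 0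
  · simp [hp]
  field_simp

lemma mult2_val (p t : ℝ) (φ : ℝ × ℝ → ℂ) (z : ℝ × ℝ) :
    mult2 (fun ζ => ((|ζ.1| ^ (1 / (2 * p)) * |ζ.2| ^ (1 / (2 * p)) : ℝ) : ℂ))
          (fun r => Ugrp r.1 φ (r.2.1, r.2.2)) (t, z.1, z.2) = 0 ∨
    (Integrable φ ∧ Integrable (Gw p (FT2 φ)) ∧
      mult2 (fun ζ => ((|ζ.1| ^ (1 / (2 * p)) * |ζ.2| ^ (1 / (2 * p)) : ℝ) : ℂ))
          (fun r => Ugrp r.1 φ (r.2.1, r.2.2)) (t, z.1, z.2) =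
        ∫ ζ, ch z ζ * (ph t ζ * Gw p (FT2 φ) ζ)) := by
  rcases FT2_Ugrp t φ with h | ⟨hφ, h⟩
  · left
    refine IFT2_zero _ (fun ζ => ?_) _
    change _ * FT2 (Ugrp t φ) ζ = 0
    rw [h, mul_zero]
  have e : mult2 (fun ζ => ((|ζ.1| ^ (1 / (2 * p)) * |ζ.2| ^ (1 / (2 * p)) : ℝ) : ℂ))
          (fun r => Ugrp r.1 φ (r.2.1, r.2.2)) (t, z.1, z.2) =
        ∫ ζ, ch z ζ * (ph t ζ * Gw p (FT2 φ) ζ) := by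
    refine integral_congr_ae ?_
    filter_upwards [symb_ae p] with ζ hζ
    change ch z ζ * (((|ζ.1| ^ (1 / (2 * p)) * |ζ.2| ^ (1 / (2 * p)) : ℝ) : ℂ) *
      FT2 (Ugrp t φ) ζ) = _
    rw [h, hζ, Gw]
    ring
  by_cases hi : Integrable (Gw p (FT2 φ))
  · exact Or.inr ⟨hφ, hi, e⟩
  · left
    rw [e]
    refine integral_undef fun h' => hi ?_
    refine unimod_int _ (fun ζ => t * (ζ.1 ^ 3 + ζ.2 ^ 3)) (by fun_prop) ?_
    exact unimod_int _ (fun ζ => 2 * Real.pi * (z.1 * ζ.1 + z.2 * ζ.2)) (by fun_prop) h'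

/-- the Strichartz type estimate
`‖I_x^{1/(2p)} I_y^{1/(2p)} U(t)φ‖_{L^p_t L^q_{x,y}} ≲ ‖φ‖_{L²}` for `2/p + 2/q = 1`, `p > 2`. -/
theorem strichartz_free_1 (p q : ℝ) (hp : 2 < p) (hpq : 2 / p + 2 / q = 1) :
    ∃ C : ℝ≥0, 0 < C ∧ ∀ φ : ℝ × ℝ → ℂ, L2N2 φ ≠ ⊤ →
      LpLq p q (mult2 (fun ζ => ((|ζ.1| ^ (1 / (2 * p)) * |ζ.2| ^ (1 / (2 * p)) : ℝ) : ℂ))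
          fun r => Ugrp r.1 φ (r.2.1, r.2.2)) ≤ (C : ℝ≥0∞) * L2N2 φ := by
  have hp0 : 0 < p := by linarith
  have h2p : 0 < 2 / p := by positivity
  have h2p1 : 2 / p < 1 := by rw [div_lt_one hp0]; exact hp
  have hq0 : 0 < q := by
    by_contra hq
    have : 2 / q ≤ 0 := div_nonpos_of_nonneg_of_nonpos (by norm_num) (not_lt.1 hq)
    linarith
  have hq : 2 < q := by
    have : 2 / q < 1 := by linarith
    rwa [div_lt_one hq0] at this
  have hpq0 : 0 < p / q := by positivity
  obtain ⟨C, hC, hG⟩ := global_est p q hp hq hpq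
  refine ⟨C, hC, fun φ hφ => ?_⟩
  by_cases hi : Integrable φ ∧ Integrable (Gw p (FT2 φ))
  · obtain ⟨hφi, hGi⟩ := hi
    have hsq : (∫⁻ ζ, (‖FT2 φ ζ‖₊ : ℝ≥0∞) ^ (2 : ℝ)) ^ (1 / 2 : ℝ) = L2N2 φ := by
      have hmem : MemLp φ 2 := by
        refine ⟨hφi.1, ?_⟩
        rw [eLpNorm_lt_top_iff_lintegral_rpow_enorm_lt_top (by norm_num) (by norm_num)]
        rw [lt_top_iff_ne_top]
        intro h
        apply hφ
        rw [L2N2]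
        have : (∫⁻ q : ℝ × ℝ, (‖φ q‖₊ : ℝ≥0∞) ^ 2) = ⊤ := by
          rw [← h]
          refine lintegral_congr fun z => ?_
          rw [ENNReal.toReal_ofNat, ENNReal.rpow_two]
          rfl
        rw [this, ENNReal.top_rpow_of_pos (by norm_num)]
      rw [FT2_plancherel φ hφi hmem, L2N2]
      simp only [ENNReal.rpow_two]
    have h := hG (FT2 φ) (FT2_continuous φ hφi) hGi
    rw [hsq] at h
    rw [LpLq]
    calc _ ≤ (((C : ℝ≥0∞) * L2N2 φ) ^ p) ^ (1 / p) := by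
          refine ENNReal.rpow_le_rpow ?_ (by positivity)
          refine le_trans ?_ h
          refine lintegral_mono fun t => ENNReal.rpow_le_rpow (lintegral_mono fun z => ?_) hpq0.le
          refine ENNReal.rpow_le_rpow ?_ hq0.le
          rcases mult2_val p t φ z with h' | ⟨_, _, h'⟩
          · rw [h']; simp
          · rw [h']
      _ = _ := by
          rw [← ENNReal.rpow_mul, mul_one_div_cancel hp0.ne', ENNReal.rpow_one]
  · have h0 : ∀ t (z : ℝ × ℝ),
        mult2 (fun ζ => ((|ζ.1| ^ (1 / (2 * p)) * |ζ.2| ^ (1 / (2 * p)) : ℝ) : ℂ))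
          (fun r => Ugrp r.1 φ (r.2.1, r.2.2)) (t, z.1, z.2) = 0 := by
      intro t z
      rcases mult2_val p t φ z with h' | ⟨h1, h2, _⟩
      · exact h'
      · exact absurd ⟨h1, h2⟩ hi
    rw [LpLq]
    simp only [h0, nnnorm_zero, ENNReal.coe_zero, ENNReal.zero_rpow_of_pos hq0, lintegral_zero,
      ENNReal.zero_rpow_of_pos hpq0]
    rw [ENNReal.zero_rpow_of_pos (by positivity)]
    exact zero_le

end
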